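/- arXiv:1804.05269 — 4 statements merged into one kernel-verified Lean document; each statement's English description precedes it below -/
import Mathlib

section
/- Let G be a countable group, let G ↷ X be an aperiodic Borel action on a standard Borel space, and let F be a countably generated class-bijective G-invariant sub-σ-algebra. Then there exist an F-expressible T ∈ [E_G^X] all of whose orbits are infinite, and an F-measurable T-invariant Borel function f : X → [0, 1], such that for all x, y ∈ X: y lies in the G-orbit of x and f(x) = f(y) if and only if y lies in the T-orbit {T^n(x) : n ∈ ℤ} of x. -/
open MeasureTheory

/-- `T` is `F`-expressible: there is an `F`-measurable partition `{Q_g : g ∈ G}` of `X` with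
`T x = g • x` for all `x ∈ Q_g`. -/
def Expressible (G : Type*) {X : Type*} [Group G] [MulAction G X]
    (F : MeasurableSpace X) (T : X ≃ X) : Prop :=
  ∃ Q : G → Set X, (∀ g, MeasurableSet[F] (Q g)) ∧
    (Pairwise fun g g' => Disjoint (Q g) (Q g')) ∧
    (⋃ g, Q g) = Set.univ ∧
    ∀ g : G, ∀ x ∈ Q g, T x = g • x

section OrbitMaps

open MulAction Filter

variable {G X : Type*} [Group G] [MulAction G X]

theorem mem_orbit_trans {x y z : X} (h₁ : y ∈ orbit G x) (h₂ : z ∈ orbit G y) :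
    z ∈ orbit G x := by
  rw [← orbit_eq_iff] at *
  rw [h₂, h₁]

/-- The pairs `x, g • x` which may be added to the matching `s` across the set `A`. -/
def Matchable (ζ : X → ℕ) (A : Set X) (g : G) (s : X → X) (y : X) : Prop :=
  y ∈ A ∧ g • y ∉ A ∧ s y = y ∧ s (g • y) = g • y ∧ ζ (g • y) = ζ y

open Classical in
/-- Add to the matching `s` all the admissible pairs `x, g • x` across `A`. -/
noncomputable def matchStep (ζ : X → ℕ) (A : Set X) (g : G) (s : X → X) (x : X) : X :=
  if Matchable ζ A g s x then g • x
  else if Matchable ζ A g s (g⁻¹ • x) then g⁻¹ • x else s x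

theorem matchStep_of_ne {ζ : X → ℕ} {A : Set X} {g : G} {s : X → X} {x : X} (h : s x ≠ x) :
    matchStep ζ A g s x = s x := by
  have h1 : ¬ Matchable ζ A g s x := fun h' => h h'.2.2.1
  have h2 : ¬ Matchable ζ A g s (g⁻¹ • x) := fun h' => h (by simpa using h'.2.2.2.1)
  simp [matchStep, h1, h2]

theorem matchStep_involutive {ζ : X → ℕ} {A : Set X} {g : G} {s : X → X}
    (hs : ∀ x, s (s x) = x) (x : X) :
    matchStep ζ A g s (matchStep ζ A g s x) = x := by
  by_cases h1 : Matchable ζ A g s x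
  · have h2 : ¬ Matchable ζ A g s (g • x) := fun h => h1.2.1 h.1
    simp [matchStep, h1, h2]
  by_cases h2 : Matchable ζ A g s (g⁻¹ • x)
  · simp [matchStep, h1, h2]
  have h3 : matchStep ζ A g s x = s x := by simp [matchStep, h1, h2]
  by_cases hx : s x = x
  · rw [h3, hx, h3, hx]
  · rw [h3, matchStep_of_ne, hs]
    rw [hs]
    exact fun h => hx h.symm

theorem matchStep_invariant {ζ : X → ℕ} {A : Set X} {g : G} {s : X → X}
    (hs : ∀ x, ζ (s x) = ζ x) (x : X) : ζ (matchStep ζ A g s x) = ζ x := by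
  unfold matchStep
  split_ifs with h1 h2
  · exact h1.2.2.2.2
  · simpa using h2.2.2.2.2.symm
  · exact hs x

open Classical in
/-- The position of `x` in its class at stage `n`, read off from the merges it has undergone. -/
noncomputable def position (r : ℕ → X → X) : ℕ → X → ℕ
  | 0, _ => 0
  | n + 1, x => position r n x + if r (n + 1) x = r n x then 0 else 2 ^ n

open Classical in
/-- The difference of the positions of two points in the same class of some stage. -/
noncomputable def positionDiff (r : ℕ → X → X) (x y : X) : ℤ :=
  if h : ∃ n, r n x = r n y then
    (position r (Nat.find h) y : ℤ) - position r (Nat.find h) x else 0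

theorem position_lt (r : ℕ → X → X) (n : ℕ) (x : X) : position r n x < 2 ^ n := by
  induction n with
  | zero => simp [position]
  | succ n ih =>
    rw [position, pow_succ]
    split_ifs <;> omega

theorem position_eq_zero {r : ℕ → X → X} {n : ℕ} {x : X}
    (h : ∀ i < n, r (i + 1) x = r i x) : position r n x = 0 := by
  induction n with
  | zero => rfl
  | succ n ih =>
    rw [position, if_pos (h n n.lt_succ_self), ih fun i hi => h i (hi.trans n.lt_succ_self)]

theorem position_add_one_eq {r : ℕ → X → X} {n : ℕ} {x : X}
    (h : ∀ i < n, r (i + 1) x ≠ r i x) : position r n x + 1 = 2 ^ n := by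
  induction n with
  | zero => rfl
  | succ n ih =>
    have := ih fun i hi => h i (hi.trans n.lt_succ_self)
    rw [position, if_neg (h n n.lt_succ_self), pow_succ]
    omega

variable [MeasurableSpace X]

/-- `u` is measurable and moves every point inside its orbit. -/
def IsOrbitMap (G : Type*) {X : Type*} [Group G] [MulAction G X] [MeasurableSpace X]
    (u : X → X) : Prop :=
  Measurable u ∧ ∀ x, u x ∈ orbit G x

/-- `φ` is measurable and injective on every orbit. -/
def IsSeparating (G : Type*) {X : Type*} [Group G] [MulAction G X] [MeasurableSpace X]
    (φ : X → ℝ) : Prop :=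
  Measurable φ ∧ ∀ x y, y ∈ orbit G x → φ x = φ y → x = y

theorem IsOrbitMap.comp {u v : X → X} (hu : IsOrbitMap G u) (hv : IsOrbitMap G v) :
    IsOrbitMap G (u ∘ v) :=
  ⟨hu.1.comp hv.1, fun x => mem_orbit_trans (hv.2 x) (hu.2 _)⟩

theorem isOrbitMap_id : IsOrbitMap G (id : X → X) :=
  ⟨measurable_id, fun x => mem_orbit_self x⟩

theorem isOrbitMap_smul [MeasurableConstSMul G X] (g : G) :
    IsOrbitMap G (fun x : X => g • x) :=
  ⟨measurable_const_smul g, fun x => mem_orbit x g⟩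

theorem IsSeparating.measurableSet_eq {φ : X → ℝ} (hφ : IsSeparating G φ) {u v : X → X}
    (hu : IsOrbitMap G u) (hv : IsOrbitMap G v) : MeasurableSet {x | u x = v x} := by
  have : {x | u x = v x} = {x | φ (u x) = φ (v x)} := by
    ext x
    refine ⟨fun h => congrArg φ h, fun h => hφ.2 _ _ ?_ h⟩
    exact mem_orbit_trans (mem_orbit_symm.1 (hu.2 x)) (hv.2 x)
  rw [this]
  exact measurableSet_eq_fun (hφ.1.comp hu.1) (hφ.1.comp hv.1)

theorem isOrbitMap_of_measurableSet_eq_smul [Countable G] [MeasurableConstSMul G X] {u : X → X}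
    (hu : ∀ x, u x ∈ orbit G x) (hm : ∀ g : G, MeasurableSet {x | u x = g • x}) :
    IsOrbitMap G u := by
  refine ⟨fun B hB => ?_, hu⟩
  have : u ⁻¹' B = ⋃ g : G, {x | u x = g • x} ∩ (fun x => g • x) ⁻¹' B := by
    ext x
    simp only [Set.mem_preimage, Set.mem_iUnion, Set.mem_inter_iff, Set.mem_ofPred_eq]
    constructor
    · intro h
      obtain ⟨g, hg⟩ := hu x
      exact ⟨g, hg.symm, by simpa [hg] using h⟩
    · rintro ⟨g, hg, h⟩
      rwa [hg]
  rw [this]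
  exact MeasurableSet.iUnion fun g => (hm g).inter (measurable_const_smul g hB)

/-- Countably many measurable sets separate each point from finite subsets of its orbit. -/
theorem IsSeparating.exists_separating_sets {φ : X → ℝ} (hφ : IsSeparating G φ) :
    ∃ A : ℕ → Set X, (∀ a, MeasurableSet (A a)) ∧ ∀ x, ∀ S : Set X, S.Finite →
      S ⊆ orbit G x → x ∉ S → ∃ a, x ∈ A a ∧ ∀ y ∈ S, y ∉ A a := by
  have hb := TopologicalSpace.isBasis_countableBasis ℝ
  obtain ⟨B, hB⟩ := (TopologicalSpace.countable_countableBasis ℝ).exists_eq_range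
    ⟨_, hb.exists_subset_of_mem_open (Set.mem_univ (0 : ℝ)) isOpen_univ |>.choose_spec.1⟩
  refine ⟨fun a => φ ⁻¹' B a, fun a => hφ.1 (hb.isOpen (hB ▸ ⟨a, rfl⟩)).measurableSet, ?_⟩
  intro x S hS hSx hx
  have hopen : IsOpen (φ '' S)ᶜ := (hS.image φ).isClosed.isOpen_compl
  have hmem : φ x ∈ (φ '' S)ᶜ := by
    rintro ⟨y, hy, hxy⟩
    exact hx (hφ.2 x y (hSx hy) hxy.symm ▸ hy)
  obtain ⟨v, hv, hxv, hvS⟩ := hb.exists_subset_of_mem_open hmem hopen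
  rw [hB] at hv
  obtain ⟨a, rfl⟩ := hv
  exact ⟨a, hxv, fun y hy hya => hvS hya ⟨y, hy, rfl⟩⟩

theorem isOrbitMap_matchStep [MeasurableConstSMul G X] {φ : X → ℝ} (hφ : IsSeparating G φ)
    {ζ : X → ℕ} (hζ : Measurable ζ) {A : Set X} (hA : MeasurableSet A) {g : G} {s : X → X}
    (hs : IsOrbitMap G s) : IsOrbitMap G (matchStep ζ A g s) := by
  have hP : MeasurableSet {y | Matchable ζ A g s y} := by
    have hg := isOrbitMap_smul (X := X) g
    refine hA.inter (MeasurableSet.inter (hg.1 hA.compl) (MeasurableSet.inter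
      (hφ.measurableSet_eq hs isOrbitMap_id) (MeasurableSet.inter
      (hφ.measurableSet_eq (hs.comp hg) hg) (measurableSet_eq_fun (hζ.comp hg.1) hζ))))
  constructor
  · refine Measurable.ite hP (measurable_const_smul g) (Measurable.ite ?_
      (measurable_const_smul g⁻¹) hs.1)
    exact measurable_const_smul g⁻¹ hP
  · intro x
    unfold matchStep
    split_ifs
    · exact mem_orbit x g
    · exact mem_orbit x g⁻¹
    · exact hs.2 x

/-- A matching within the cells of `ζ` leaving at most one point per orbit and cell. -/
theorem IsSeparating.exists_maximal_matching [Countable G] [MeasurableConstSMul G X] {φ : X → ℝ}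
    (hφ : IsSeparating G φ) {ζ : X → ℕ} (hζ : Measurable ζ) :
    ∃ s : X → X, IsOrbitMap G s ∧ (∀ x, s (s x) = x) ∧ (∀ x, ζ (s x) = ζ x) ∧
      ∀ x y, y ∈ orbit G x → ζ x = ζ y → s x = x → s y = y → x = y := by
  classical
  obtain ⟨A, hA, hsep⟩ := hφ.exists_separating_sets
  obtain ⟨e, he⟩ := exists_surjective_nat (G × ℕ)
  obtain ⟨S, hS0, hS1⟩ : ∃ S : ℕ → X → X, S 0 = id ∧
      ∀ k, S (k + 1) = matchStep ζ (A (e k).2) (e k).1 (S k) :=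
    ⟨fun k => Nat.rec id (fun n s => matchStep ζ (A (e n).2) (e n).1 s) k, rfl, fun _ => rfl⟩
  have hSo : ∀ k, IsOrbitMap G (S k) := by
    intro k
    induction k with
    | zero => exact hS0 ▸ isOrbitMap_id
    | succ k ih => exact hS1 k ▸ isOrbitMap_matchStep hφ hζ (hA _) ih
  have hSi : ∀ k x, S k (S k x) = x := by
    intro k
    induction k with
    | zero => simp [hS0]
    | succ k ih => exact hS1 k ▸ matchStep_involutive ih
  have hSζ : ∀ k x, ζ (S k x) = ζ x := by
    intro k
    induction k with
    | zero => simp [hS0]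
    | succ k ih => exact hS1 k ▸ matchStep_invariant ih
  have hstab : ∀ k l x, k ≤ l → S k x ≠ x → S l x = S k x := by
    intro k l x hkl hk
    induction l, hkl using Nat.le_induction with
    | base => rfl
    | succ l _ ih => rw [hS1, matchStep_of_ne (by rwa [ih]), ih]
  have hlim : ∀ x, ∃ y, ∀ᶠ l in atTop, S l x = y := by
    intro x
    by_cases h : ∃ k, S k x ≠ x
    · obtain ⟨k, hk⟩ := h
      exact ⟨S k x, eventually_atTop.2 ⟨k, fun l hl => hstab k l x hl hk⟩⟩
    · push Not at h
      exact ⟨x, Eventually.of_forall h⟩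
  choose s hs using hlim
  have hfix : ∀ x, s x = x → ∀ k, S k x = x := by
    intro x hx k
    by_contra hk
    obtain ⟨l, hl, hkl⟩ := ((hs x).and (eventually_ge_atTop k)).exists
    exact hk (by rw [← hstab k l x hkl hk, hl, hx])
  have horb : ∀ x, s x ∈ orbit G x := by
    intro x
    obtain ⟨l, hl⟩ := (hs x).exists
    exact hl ▸ (hSo l).2 x
  refine ⟨s, isOrbitMap_of_measurableSet_eq_smul horb ?_, ?_, ?_, ?_⟩
  · intro g
    have : {x | s x = g • x} = ⋃ k, ⋂ l, ⋂ (_ : k ≤ l), {x | S l x = g • x} := by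
      ext x
      simp only [Set.mem_iUnion, Set.mem_iInter, Set.mem_ofPred_eq]
      rw [← eventually_atTop]
      constructor
      · intro h
        exact (hs x).mono fun l hl => hl.trans h
      · intro h
        obtain ⟨l, hl, hl'⟩ := (h.and (hs x)).exists
        exact hl'.symm.trans hl
    rw [this]
    exact MeasurableSet.iUnion fun k => MeasurableSet.iInter fun l => MeasurableSet.iInter
      fun _ => hφ.measurableSet_eq (hSo l) (isOrbitMap_smul g)
  · intro x
    obtain ⟨l, hl, hl'⟩ := ((hs x).and (hs (s x))).exists
    rw [← hl', ← hl, hSi]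
  · intro x
    obtain ⟨l, hl⟩ := (hs x).exists
    rw [← hl, hSζ]
  · rintro x _ ⟨g, rfl⟩ hxy hx hy
    by_contra hne
    obtain ⟨a, hxa, hya⟩ := hsep x {g • x} (Set.finite_singleton _)
      (Set.singleton_subset_iff.2 (mem_orbit x g)) (by simpa using hne)
    obtain ⟨k, hk⟩ := he (g, a)
    have hm : Matchable ζ (A (e k).2) (e k).1 (S k) x := by
      rw [hk]
      exact ⟨hxa, hya _ rfl, hfix x hx k, hfix _ hy k, hxy.symm⟩
    have := hfix x hx (k + 1)
    rw [hS1, matchStep, if_pos hm, hk] at this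
    exact hne this.symm

/-- A countable colouring of the classes of `r` separating the classes linked by `g`. -/
theorem IsSeparating.exists_coloring [Countable G] [MeasurableConstSMul G X] {φ : X → ℝ}
    (hφ : IsSeparating G φ) {r : X → X} (hr : IsOrbitMap G r)
    (hfin : ∀ x, {y | r y = x}.Finite) (g : G) :
    ∃ c : X → ℕ, Measurable c ∧ (∀ x y, r x = r y → c x = c y) ∧
      ∀ x, r x ≠ r (g • x) → c x ≠ c (g • x) := by
  classical
  obtain ⟨A, hA, hsep⟩ := hφ.exists_separating_sets
  let p : X → ℕ → Prop := fun w a =>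
    w ∈ A a ∧ ∀ z, r z = w → r (g • z) ≠ w → r (g • z) ∉ A a
  have hex : ∀ x, ∃ a, p (r x) a := by
    intro x
    obtain ⟨a, ha, ha'⟩ := hsep (r x)
      ((fun z => r (g • z)) '' {z | r z = r x} \ {r x})
      (((hfin (r x)).image _).sdiff)
      (by
        rintro _ ⟨⟨z, hz, rfl⟩, -⟩
        refine mem_orbit_trans ?_ (mem_orbit_trans (mem_orbit z g) (hr.2 _))
        exact mem_orbit_symm.1 ((show r z = r x from hz) ▸ hr.2 z))
      (by simp)
    exact ⟨a, ha, fun z hz hne => ha' _ ⟨⟨z, hz, rfl⟩, hne⟩⟩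
  refine ⟨fun x => Nat.find (hex x), measurable_find hex fun a => ?_, ?_, ?_⟩
  · have : {x | p (r x) a} = r ⁻¹' A a ∩ ⋂ h : G, ({x | r (h • x) = r x}ᶜ ∪
        ({x | r (g • h • x) = r x} ∪ ((fun x => r (g • h • x)) ⁻¹' A a)ᶜ)) := by
      ext x
      simp only [p, Set.mem_ofPred_eq, Set.mem_inter_iff, Set.mem_preimage, Set.mem_iInter,
        Set.mem_union, Set.mem_compl_iff]
      refine and_congr_right fun _ => ⟨fun H h => ?_, fun H z hz hne => ?_⟩
      · have := H (h • x)
        tauto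
      · have hzx : z ∈ orbit G x :=
          mem_orbit_trans (hr.2 x) (mem_orbit_symm.1 (hz ▸ hr.2 z))
        obtain ⟨h, rfl⟩ := hzx
        have := H h
        tauto
    rw [this]
    have hg := fun k : G => isOrbitMap_smul (X := X) k
    refine (hr.1 (hA a)).inter (MeasurableSet.iInter fun h => MeasurableSet.union ?_
      (MeasurableSet.union ?_ ?_))
    · exact (hφ.measurableSet_eq (hr.comp (hg h)) hr).compl
    · exact hφ.measurableSet_eq (hr.comp ((hg g).comp (hg h))) hr
    · exact ((hr.comp ((hg g).comp (hg h))).1 (hA a)).compl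
  · intro x y hxy
    simp only [hxy]
  · intro x hne heq
    have h1 := Nat.find_spec (hex x)
    have h2 := Nat.find_spec (hex (g • x))
    dsimp only at heq
    rw [← heq] at h2
    exact h1.2 x rfl hne.symm h2.1

/-- A subrelation carrying an integer-valued cocycle that enumerates each class in order type
`ℤ` is generated by a single bijection. -/
theorem exists_equiv_of_cocycle {R : X → X → Prop} (hR : Equivalence R) {ρ : X → X → ℤ}
    (hadd : ∀ x y z, R x y → R y z → ρ x z = ρ x y + ρ y z)
    (hinj : ∀ x y, R x y → ρ x y = 0 → x = y)
    (hsucc : ∀ x, ∃ y, R x y ∧ ρ x y = 1)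
    (hpred : ∀ x, ∃ y, R x y ∧ ρ x y = -1)
    (hmeas : ∀ g : G, MeasurableSet {x | R x (g • x) ∧ ρ x (g • x) = 1}) :
    ∃ T : X ≃ X, (∀ g : G, MeasurableSet {x | T x = g • x}) ∧
      (∀ (x : X) (n : ℤ), n ≠ 0 → (T ^ n : Equiv.Perm X) x ≠ x) ∧
      ∀ x y, R x y ↔ ∃ n : ℤ, (T ^ n : Equiv.Perm X) x = y := by
  have hself : ∀ x, ρ x x = 0 := fun x => by
    have := hadd x x x (hR.refl x) (hR.refl x)
    omega
  have hneg : ∀ x y, R x y → ρ y x = - ρ x y := fun x y h => by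
    have := hadd x y x h (hR.symm h)
    have := hself x
    omega
  have huniq : ∀ x y z, R x y → R x z → ρ x y = ρ x z → y = z := fun x y z hy hz h => by
    refine hinj y z (hR.trans (hR.symm hy) hz) ?_
    have := hadd y x z (hR.symm hy) hz
    have := hneg x y hy
    omega
  choose t ht using hsucc
  choose t' ht' using hpred
  let T : X ≃ X :=
    { toFun := t
      invFun := t'
      left_inv := fun x => by
        refine (hinj _ _ (hR.trans (ht x).1 (ht' _).1) ?_).symm
        have := hadd _ _ _ (ht x).1 (ht' (t x)).1
        have := (ht x).2
        have := (ht' (t x)).2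
        omega
      right_inv := fun x => by
        refine (hinj _ _ (hR.trans (ht' x).1 (ht _).1) ?_).symm
        have := hadd _ _ _ (ht' x).1 (ht (t' x)).1
        have := (ht' x).2
        have := (ht (t' x)).2
        omega }
  have hpow : ∀ (n : ℤ) (x : X), R x ((T ^ n : Equiv.Perm X) x) ∧
      ρ x ((T ^ n : Equiv.Perm X) x) = n := by
    intro n
    induction n with
    | zero => exact fun x => ⟨hR.refl x, hself x⟩
    | succ n ih =>
      intro x
      have h1 : ((T ^ ((n : ℤ) + 1) : Equiv.Perm X)) x = t ((T ^ (n : ℤ) : Equiv.Perm X) x) := by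
        rw [add_comm, zpow_add, zpow_one]
        rfl
      rw [h1, hadd _ _ _ (ih x).1 (ht _).1, (ih x).2, (ht _).2]
      exact ⟨hR.trans (ih x).1 (ht _).1, rfl⟩
    | pred n ih =>
      intro x
      have h1 : ((T ^ (-(n : ℤ) - 1) : Equiv.Perm X)) x =
          t' ((T ^ (-(n : ℤ)) : Equiv.Perm X) x) := by
        rw [sub_eq_add_neg, add_comm, zpow_add, zpow_neg_one]
        rfl
      rw [h1, hadd _ _ _ (ih x).1 (ht' _).1, (ih x).2, (ht' _).2]
      exact ⟨hR.trans (ih x).1 (ht' _).1, rfl⟩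
  refine ⟨T, fun g => ?_, fun x n hn h => ?_, fun x y => ⟨fun h => ⟨ρ x y, ?_⟩, ?_⟩⟩
  · convert hmeas g using 1
    ext x
    constructor
    · intro h
      have h' : t x = g • x := h
      simpa only [Set.mem_ofPred_eq, ← h'] using ht x
    · rintro ⟨h1, h2⟩
      exact huniq x _ _ (ht x).1 h1 ((ht x).2.trans h2.symm)
  · have := (hpow n x).2
    rw [h, hself] at this
    exact hn this.symm
  · exact huniq x _ _ (hpow _ x).1 h (hpow _ x).2
  · rintro ⟨n, rfl⟩
    exact (hpow n x).1

theorem measurable_count {P : X → ℕ → Prop} [∀ x, DecidablePred (P x)]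
    (hP : ∀ m, MeasurableSet {x | P x m}) {i : X → ℕ} (hi : Measurable i) :
    Measurable fun x => Nat.count (P x) (i x) := by
  have h : ∀ n, Measurable fun x => Nat.count (P x) n := by
    intro n
    induction n with
    | zero => simp
    | succ n ih =>
      simp only [Nat.count_succ]
      exact ih.add (Measurable.ite (hP n) measurable_const measurable_const)
  have := measurable_from_prod_countable_right (f := fun q : ℕ × X => Nat.count (P q.2) q.1) h
  exact this.comp (hi.prodMk measurable_id)

/-- On the classes that meet one of countably many partial transversals, a measurable
subrelation with infinite classes carries a cocycle enumerating each class in order type `ℤ`. -/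
theorem exists_cocycle_of_partial_transversals [Countable G] [MeasurableConstSMul G X]
    {R : X → X → Prop} (hR : Equivalence R) (hRo : ∀ x y, R x y → y ∈ orbit G x)
    (hRm : ∀ g : G, MeasurableSet {x | R x (g • x)}) (hRinf : ∀ x, {y | R x y}.Infinite)
    {ι : Type*} [Countable ι] [Nonempty ι] {V : ι → Set X} (hV : ∀ i, MeasurableSet (V i))
    (hV1 : ∀ i x y, R x y → x ∈ V i → y ∈ V i → x = y) :
    ∃ ρ : X → X → ℤ, MeasurableSet {x | ∃ i y, R x y ∧ y ∈ V i} ∧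
      (∀ x y z, ρ x z = ρ x y + ρ y z) ∧
      (∀ x y, (∃ i y, R x y ∧ y ∈ V i) → R x y → ρ x y = 0 → x = y) ∧
      (∀ x k, (∃ i y, R x y ∧ y ∈ V i) → ∃ y, R x y ∧ ρ x y = k) ∧
      ∀ g : G, MeasurableSet {x | ρ x (g • x) = 1} := by
  classical
  obtain ⟨e, he⟩ := exists_surjective_nat (ι × G)
  let p : X → ℕ → Prop := fun x k => R x ((e k).2 • x) ∧ (e k).2 • x ∈ V (e k).1
  have hpm : ∀ k, MeasurableSet {x | p x k} := fun k =>
    (hRm _).inter (measurable_const_smul (e k).2 (hV _))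
  have hY : ∀ x, (∃ i y, R x y ∧ y ∈ V i) ↔ ∃ k, p x k := by
    intro x
    constructor
    · rintro ⟨i, y, hxy, hy⟩
      obtain ⟨g, rfl⟩ := hRo x y hxy
      obtain ⟨k, hk⟩ := he (i, g)
      exact ⟨k, by simpa [p, hk] using ⟨hxy, hy⟩⟩
    · rintro ⟨k, h1, h2⟩
      exact ⟨_, _, h1, h2⟩
  have hYm : MeasurableSet {x | ∃ k, p x k} := by
    rw [show {x | ∃ k, p x k} = ⋃ k, {x | p x k} by ext; simp]
    exact MeasurableSet.iUnion hpm
  have hYR : ∀ x y, R x y → (∃ k, p x k) → ∃ k, p y k := by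
    intro x y hxy hx
    rw [← hY] at hx ⊢
    obtain ⟨i, z, hz, hzV⟩ := hx
    exact ⟨i, z, hR.trans (hR.symm hxy) hz, hzV⟩
  have hex : ∀ x, ∃ k, (p x k ∨ ¬ ∃ k, p x k) := by
    intro x
    by_cases h : ∃ k, p x k
    · exact h.imp fun k hk => Or.inl hk
    · exact ⟨0, Or.inr h⟩
  let i : X → ℕ := fun x => Nat.find (hex x)
  have hi : Measurable i := measurable_find hex fun k => (hpm k).union hYm.compl
  have hip : ∀ x, (∃ k, p x k) → p x (i x) := fun x hx =>
    (Nat.find_spec (hex x)).resolve_right (not_not.2 hx)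
  have hiinj : ∀ x y, (∃ k, p x k) → R x y → i x = i y → x = y := by
    intro x y hx hxy hxyi
    have h1 := hip x hx
    have h2 := hip y (hYR x y hxy hx)
    rw [← hxyi] at h2
    have := hV1 _ _ _ (hR.trans (hR.symm h1.1) (hR.trans hxy h2.1)) h1.2 h2.2
    exact smul_left_cancel _ this
  let P : X → ℕ → Prop := fun x m => ∃ y, R x y ∧ i y = m
  have hPR : ∀ x y, R x y → P x = P y := by
    intro x y hxy
    ext m
    exact ⟨fun ⟨z, hz, hm⟩ => ⟨z, hR.trans (hR.symm hxy) hz, hm⟩,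
      fun ⟨z, hz, hm⟩ => ⟨z, hR.trans hxy hz, hm⟩⟩
  have hPm : ∀ m, MeasurableSet {x | P x m} := by
    intro m
    have : {x | P x m} = ⋃ g : G, {x | R x (g • x)} ∩ (fun x => g • x) ⁻¹' (i ⁻¹' {m}) := by
      ext x
      simp only [P, Set.mem_ofPred_eq, Set.mem_iUnion, Set.mem_inter_iff, Set.mem_preimage,
        Set.mem_singleton_iff]
      constructor
      · rintro ⟨y, hy, hm⟩
        obtain ⟨g, rfl⟩ := hRo x y hy
        exact ⟨g, hy, hm⟩
      · rintro ⟨g, hy, hm⟩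
        exact ⟨_, hy, hm⟩
    rw [this]
    exact MeasurableSet.iUnion fun g =>
      (hRm g).inter (measurable_const_smul g (hi (measurableSet_singleton m)))
  have hPinf : ∀ x, (∃ k, p x k) → (Set.ofPred (P x)).Infinite := by
    intro x hx
    refine ((hRinf x).image (f := i) ?_).mono ?_
    · intro y hy z hz hyz
      exact hiinj y z (hYR x y hy hx) (hR.trans (hR.symm hy) hz) hyz
    · rintro _ ⟨y, hy, rfl⟩
      exact ⟨y, hy, rfl⟩
  let j : X → ℕ := fun x => Nat.count (P x) (i x)
  have hj : Measurable j := measurable_count hPm hi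
  let σ := Equiv.intEquivNat.symm
  refine ⟨fun x y => σ (j y) - σ (j x), ?_, fun x y z => by ring, ?_, ?_, ?_⟩
  · simpa only [hY] using hYm
  · intro x y hx hxy h
    have h1 : j x = j y := σ.injective (sub_eq_zero.1 h).symm
    refine hiinj x y ((hY x).1 hx) hxy (Nat.count_injective (p := P x) ⟨x, hR.refl x, rfl⟩
      ⟨y, hxy, rfl⟩ ?_)
    change Nat.count (P x) (i x) = Nat.count (P y) (i y) at h1
    simpa only [hPR x y hxy] using h1
  · intro x k hx
    rw [hY] at hx
    obtain ⟨y, hy, hm⟩ := Nat.nth_mem_of_infinite (hPinf x hx) (σ.symm (k + σ (j x)))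
    refine ⟨y, hy, ?_⟩
    have : j y = σ.symm (k + σ (j x)) := by
      change Nat.count (P y) (i y) = _
      rw [hm]
      simp only [← hPR x y hy]
      exact Nat.count_nth_of_infinite (hPinf x hx) _
    change σ (j y) - σ (j x) = k
    rw [this, Equiv.apply_symm_apply]
    ring
  · intro g
    refine measurableSet_eq_fun ?_ measurable_const
    have hσ : Measurable fun x => σ (j x) := (measurable_of_countable σ).comp hj
    exact (hσ.comp (measurable_const_smul g)).sub hσ

/-- `r` selects representatives of a measurable equivalence relation with finite classes, and
`ξ` labels its classes. -/
structure IsStage (G : Type*) {X : Type*} [Group G] [MulAction G X] [MeasurableSpace X]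
    (r : X → X) (ξ : X → ℕ) : Prop where
  orb : IsOrbitMap G r
  idem : ∀ x, r (r x) = r x
  fin : ∀ x, {y | r y = x}.Finite
  meas : Measurable ξ
  inv : ∀ x, ξ (r x) = ξ x

/-- The stage `(r', ξ')` arises from `(r, ξ)` by refining the labels so that they separate the
distinct classes linked by `g`, and then merging pairs of classes with the same label along the
maximal matching `s`. -/
structure IsRefinement (g : G) (r : X → X) (ξ : X → ℕ) (s r' : X → X) (ξ' : X → ℕ) :
    Prop where
  orb : IsOrbitMap G s
  invol : ∀ x, s (s x) = x
  swap : ∀ x, r x = x → r (s x) = s x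
  split : ∀ x, r' x = r x ∨ r' x = s (r x)
  merge : ∀ x, r x = x → r' (s x) = r' x
  range : ∀ x, r (r' x) = r' x
  factor : ∀ x, r' (r x) = r' x
  label : ∀ x y, ξ' x = ξ' y → ξ x = ξ y
  separate : ∀ x, r x ≠ r (g • x) → ξ' x ≠ ξ' (g • x)
  maximal : ∀ x y, y ∈ orbit G x → ξ' x = ξ' y → r x = x → r y = y → s x = x → s y = y → x = y

theorem IsStage.exists_refinement [Countable G] [MeasurableConstSMul G X] {φ : X → ℝ}
    (hφ : IsSeparating G φ) {r : X → X} {ξ : X → ℕ} (h : IsStage G r ξ) (g : G) :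
    ∃ s r' ξ', IsStage G r' ξ' ∧ IsRefinement g r ξ s r' ξ' := by
  classical
  obtain ⟨c, hc, hcr, hcg⟩ := hφ.exists_coloring h.orb h.fin g
  have hpair : Measurable fun q : ℕ × ℕ => Nat.pair q.1 q.2 := measurable_of_countable _
  let ξ' : X → ℕ := fun x => Nat.pair (ξ x) (c x)
  have hξ' : Measurable ξ' := hpair.comp (h.meas.prodMk hc)
  have hξ'r : ∀ x, ξ' (r x) = ξ' x := fun x => by
    simp only [ξ', h.inv, hcr _ _ (h.idem x)]
  let ζ : X → ℕ := fun x => Nat.pair (ξ' x) (if r x = x then 1 else 0)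
  have hζ : Measurable ζ := hpair.comp (hξ'.prodMk
    (Measurable.ite (hφ.measurableSet_eq h.orb isOrbitMap_id) measurable_const measurable_const))
  obtain ⟨s, hs, hsi, hsζ, hmax⟩ := hφ.exists_maximal_matching hζ
  have hsξ : ∀ x, ξ' (s x) = ξ' x := fun x => (Nat.pair_eq_pair.1 (hsζ x)).1
  have hsr : ∀ x, r x = x → r (s x) = s x := by
    intro x hx
    have := (Nat.pair_eq_pair.1 (hsζ x)).2
    by_contra hne
    simp [hx, hne] at this
  let m : X → X := fun x => if φ x ≤ φ (s x) then x else s x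
  have hms : ∀ x, m (s x) = m x := by
    intro x
    simp only [m, hsi]
    split_ifs with h1 h2 h2
    · exact (hφ.2 _ _ (hs.2 x) (le_antisymm h2 h1)).symm
    · rfl
    · rfl
    · exact absurd (le_of_not_ge h1) h2
  have hmor : ∀ x, m x = x ∨ m x = s x := by
    intro x
    simp only [m]
    split_ifs <;> simp
  have hmm : ∀ x, m (m x) = m x := by
    intro x
    rcases hmor x with h1 | h1
    · rw [h1, h1]
    · rw [h1, hms, h1]
  have hmr : ∀ x, r x = x → r (m x) = m x := by
    intro x hx
    rcases hmor x with h1 | h1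
    · rw [h1, hx]
    · rw [h1, hsr x hx]
  have hmξ : ∀ x, ξ' (m x) = ξ' x := by
    intro x
    rcases hmor x with h1 | h1 <;> simp only [h1, hsξ]
  have hmo : IsOrbitMap G m := by
    refine ⟨Measurable.ite (measurableSet_le hφ.1 (hφ.1.comp hs.1)) measurable_id hs.1, ?_⟩
    intro x
    rcases hmor x with h1 | h1 <;> rw [h1]
    · exact mem_orbit_self x
    · exact hs.2 x
  refine ⟨s, m ∘ r, ξ', ⟨hmo.comp h.orb, ?_, ?_, hξ', ?_⟩, ⟨hs, hsi, hsr, ?_, ?_, ?_, ?_, ?_,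
    ?_, ?_⟩⟩
  · intro x
    simp only [Function.comp, hmr _ (h.idem x), hmm]
  · intro x
    refine ((h.fin x).union (h.fin (s x))).subset ?_
    intro y hy
    have hy' : m (r y) = x := hy
    rcases hmor (r y) with h1 | h1
    · exact Or.inl (h1.symm.trans hy')
    · refine Or.inr ?_
      change r y = s x
      rw [← hy', h1, hsi]
  · intro x
    simp only [Function.comp, hmξ, hξ'r]
  · exact fun x => hmor (r x)
  · intro x hx
    simp only [Function.comp, hx, hsr x hx, hms]
  · exact fun x => hmr _ (h.idem x)
  · intro x
    simp only [Function.comp, h.idem]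
  · exact fun x y hxy => (Nat.pair_eq_pair.1 hxy).1
  · exact fun x hne heq => hcg x hne (Nat.pair_eq_pair.1 heq).2
  · intro x y hxy hξ hx hy
    refine hmax x y hxy ?_
    simp only [ζ, hξ, hx, hy]

/-- A sequence of stages, each refining the previous one. -/
structure IsTower (e : ℕ → G) (r s : ℕ → X → X) (ξ : ℕ → X → ℕ) : Prop where
  zero : ∀ x, r 0 x = x
  stage : ∀ n, IsStage G (r n) (ξ n)
  step : ∀ n, IsRefinement (e n) (r n) (ξ n) (s n) (r (n + 1)) (ξ (n + 1))

theorem exists_isTower [Countable G] [MeasurableConstSMul G X] {φ : X → ℝ}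
    (hφ : IsSeparating G φ) (e : ℕ → G) : ∃ r s ξ, IsTower (X := X) e r s ξ := by
  let Q := {q : (X → X) × (X → ℕ) // IsStage G q.1 q.2}
  have hnext : ∀ (n : ℕ) (q : Q), ∃ q' : Q, ∃ s : X → X,
      IsRefinement (e n) q.1.1 q.1.2 s q'.1.1 q'.1.2 := by
    intro n q
    obtain ⟨s, r', ξ', h1, h2⟩ := q.2.exists_refinement hφ (e n)
    exact ⟨⟨(r', ξ'), h1⟩, s, h2⟩
  choose next s hs using hnext
  have h0 : IsStage G (id : X → X) (fun _ => 0) :=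
    ⟨isOrbitMap_id, fun _ => rfl, fun x => Set.finite_singleton x, measurable_const, fun _ => rfl⟩
  obtain ⟨q, hq0, hq⟩ : ∃ q : ℕ → Q, q 0 = ⟨(id, fun _ => 0), h0⟩ ∧
      ∀ n, q (n + 1) = next n (q n) :=
    ⟨fun n => Nat.rec ⟨(id, fun _ => 0), h0⟩ next n, rfl, fun _ => rfl⟩
  refine ⟨fun n => (q n).1.1, fun n => s n (q n), fun n => (q n).1.2, ?_, fun n => (q n).2, ?_⟩
  · intro x
    simp [hq0]
  · intro n
    simp only [hq]
    exact hs n (q n)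

namespace IsTower

variable {e : ℕ → G} {r s : ℕ → X → X} {ξ : ℕ → X → ℕ}

theorem eq_of_le (h : IsTower e r s ξ) {n m : ℕ} (hnm : n ≤ m) {x y : X}
    (hxy : r n x = r n y) : r m x = r m y := by
  induction m, hnm using Nat.le_induction with
  | base => exact hxy
  | succ m _ ih => rw [← (h.step m).factor x, ← (h.step m).factor y, ih]

theorem fixed_of_le (h : IsTower e r s ξ) {n m : ℕ} (hnm : n ≤ m) {x : X}
    (hx : r m x = x) : r n x = x := by
  induction m, hnm using Nat.le_induction with
  | base => exact hx
  | succ m _ ih =>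
    refine ih ?_
    have := (h.step m).range x
    rwa [hx] at this

theorem label_of_le (h : IsTower e r s ξ) {n m : ℕ} (hnm : n ≤ m) {x y : X}
    (hxy : ξ m x = ξ m y) : ξ n x = ξ n y := by
  induction m, hnm using Nat.le_induction with
  | base => exact hxy
  | succ m _ ih => exact ih ((h.step m).label _ _ hxy)

theorem mem_orbit_of_eq (h : IsTower e r s ξ) {n : ℕ} {x y : X} (hxy : r n x = r n y) :
    y ∈ orbit G x :=
  mem_orbit_trans ((h.stage n).orb.2 x) (mem_orbit_symm.1 (hxy ▸ (h.stage n).orb.2 y))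

theorem exists_eq_iff (h : IsTower e r s ξ) (he : Function.Surjective e) {x y : X}
    (hxy : y ∈ orbit G x) : (∃ n, r n x = r n y) ↔ ∀ n, ξ n x = ξ n y := by
  constructor
  · rintro ⟨n, hn⟩ m
    refine h.label_of_le (le_max_right n m) ?_
    rw [← (h.stage _).inv x, ← (h.stage _).inv y, h.eq_of_le (le_max_left n m) hn]
  · intro H
    obtain ⟨g, rfl⟩ := hxy
    obtain ⟨n, rfl⟩ := he g
    by_contra hne
    push Not at hne
    exact (h.step n).separate x (hne n) (H (n + 1))

end IsTower

theorem measurable_position [Countable G] [MeasurableConstSMul G X] {φ : X → ℝ}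
    (hφ : IsSeparating G φ) {r : ℕ → X → X} (hr : ∀ n, IsOrbitMap G (r n)) (n : ℕ) :
    Measurable (position r n) := by
  induction n with
  | zero => exact measurable_const
  | succ n ih =>
    exact ih.add (Measurable.ite (hφ.measurableSet_eq (hr (n + 1)) (hr n)) measurable_const
      measurable_const)

namespace IsTower

variable {e : ℕ → G} {r s : ℕ → X → X} {ξ : ℕ → X → ℕ}

theorem eq_of_position_eq (h : IsTower e r s ξ) {n : ℕ} {x y : X} (hxy : r n x = r n y)
    (hp : position r n x = position r n y) : x = y := by
  induction n with
  | zero => rwa [h.zero, h.zero] at hxy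
  | succ n ih =>
    have hx := position_lt r n x
    have hy := position_lt r n y
    simp only [position] at hp
    have hsx := (h.step n).split x
    have hsy := (h.step n).split y
    by_cases h1 : r (n + 1) x = r n x <;> by_cases h2 : r (n + 1) y = r n y
    · exact ih (by rw [← h1, ← h2, hxy]) (by simpa [h1, h2] using hp)
    · simp only [h1, h2, if_true, if_false] at hp
      omega
    · simp only [h1, h2, if_true, if_false] at hp
      omega
    · refine ih ?_ (by simpa [h1, h2] using hp)
      rw [← (h.step n).invol (r n x), ← (h.step n).invol (r n y), ← hsx.resolve_left h1,
        ← hsy.resolve_left h2, hxy]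

theorem positionDiff_eq (h : IsTower e r s ξ) {n : ℕ} {x y : X} (hxy : r n x = r n y) :
    positionDiff r x y = (position r n y : ℤ) - position r n x := by
  classical
  have key : ∀ k m, k ≤ m → r k x = r k y →
      (position r m y : ℤ) - position r m x = (position r k y : ℤ) - position r k x := by
    intro k m hkm hk
    induction m, hkm using Nat.le_induction with
    | base => rfl
    | succ m hm ih =>
      rw [← ih]
      simp only [position, h.eq_of_le hm hk, h.eq_of_le (hm.trans m.le_succ) hk]
      push_cast
      ring
  have hex : ∃ n, r n x = r n y := ⟨n, hxy⟩
  rw [positionDiff, dif_pos hex, key _ n (Nat.find_min' hex hxy) (Nat.find_spec hex)]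

theorem positionDiff_add (h : IsTower e r s ξ) {x y z : X} (hxy : ∃ n, r n x = r n y)
    (hyz : ∃ n, r n y = r n z) :
    positionDiff r x z = positionDiff r x y + positionDiff r y z := by
  obtain ⟨n, hn⟩ := hxy
  obtain ⟨m, hm⟩ := hyz
  have h1 := h.eq_of_le (le_max_left n m) hn
  have h2 := h.eq_of_le (le_max_right n m) hm
  rw [h.positionDiff_eq h1, h.positionDiff_eq h2, h.positionDiff_eq (h1.trans h2)]
  ring

theorem eq_of_positionDiff_eq_zero (h : IsTower e r s ξ) {x y : X} (hxy : ∃ n, r n x = r n y)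
    (h0 : positionDiff r x y = 0) : x = y := by
  obtain ⟨n, hn⟩ := hxy
  rw [h.positionDiff_eq hn] at h0
  exact h.eq_of_position_eq hn (by omega)

theorem exists_positionDiff_eq_one (h : IsTower e r s ξ) {x : X}
    (hx : ∀ n, s n (r n x) ≠ r n x) (h0 : ∃ n, r (n + 1) x = r n x) :
    ∃ y, (∃ n, r n x = r n y) ∧ positionDiff r x y = 1 := by
  classical
  have hn := Nat.find_spec h0
  have hmin : ∀ i < Nat.find h0, r (i + 1) x ≠ r i x := fun i hi => Nat.find_min h0 hi
  generalize Nat.find h0 = n at hn hmin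
  have hy : r n (s n (r n x)) = s n (r n x) := (h.step n).swap _ ((h.stage n).idem x)
  have hy' : r (n + 1) (s n (r n x)) = r (n + 1) x := by
    rw [(h.step n).merge _ ((h.stage n).idem x), (h.step n).factor]
  refine ⟨s n (r n x), ⟨n + 1, hy'.symm⟩, ?_⟩
  rw [h.positionDiff_eq hy'.symm, position, position, if_pos hn,
    if_neg (by rw [hy', hy, hn]; exact (hx n).symm), position_eq_zero]
  · have hp : (position r n x : ℤ) + 1 = 2 ^ n := mod_cast position_add_one_eq hmin
    push_cast
    linarith
  · intro i hi
    rw [h.fixed_of_le hi hy, h.fixed_of_le hi.le hy]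

theorem exists_position_add_one_eq (h : IsTower e r s ξ) {n : ℕ} {z : X}
    (hz : ∀ y ∈ orbit G z, ∀ n, s n (r n y) ≠ r n y) (hnz : r n z = z) :
    ∃ w, r n w = z ∧ position r n w + 1 = 2 ^ n := by
  induction n generalizing z with
  | zero => exact ⟨z, hnz, rfl⟩
  | succ n ih =>
    have hz' := h.fixed_of_le n.le_succ hnz
    have hsz := (h.step n).swap z hz'
    obtain ⟨w, hw, hp⟩ := ih (z := s n z)
      (fun y hy => hz y (mem_orbit_trans ((h.step n).orb.2 z) hy)) hsz
    have hw' : r (n + 1) w = z := by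
      rw [← (h.step n).factor, hw, (h.step n).merge z hz', hnz]
    have hne : r (n + 1) w ≠ r n w := by
      have := hz z (mem_orbit_self z) n
      rw [hz'] at this
      rw [hw', hw]
      exact this.symm
    refine ⟨w, hw', ?_⟩
    rw [position, if_neg hne, pow_succ]
    omega

theorem exists_positionDiff_eq_neg_one (h : IsTower e r s ξ) {x : X}
    (hx : ∀ y ∈ orbit G x, ∀ n, s n (r n y) ≠ r n y) (h1 : ∃ n, r (n + 1) x ≠ r n x) :
    ∃ y, (∃ n, r n x = r n y) ∧ positionDiff r x y = -1 := by
  classical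
  have hn := Nat.find_spec h1
  have hmin : ∀ i < Nat.find h1, r (i + 1) x = r i x :=
    fun i hi => not_not.1 (Nat.find_min h1 hi)
  generalize Nat.find h1 = n at hn hmin
  have hxn : r n x = x := by
    have : ∀ i ≤ n, r i x = x := by
      intro i hi
      induction i with
      | zero => exact h.zero x
      | succ i ih => rw [hmin i hi, ih (by omega)]
    exact this n le_rfl
  have hsx := (h.step n).swap x hxn
  have hx' : r (n + 1) x = s n x := by
    have := ((h.step n).split x).resolve_left hn
    rwa [hxn] at this
  obtain ⟨w, hw, hp⟩ := h.exists_position_add_one_eq (z := s n x)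
    (fun y hy => hx y (mem_orbit_trans ((h.step n).orb.2 x) hy)) hsx
  have hw' : r (n + 1) w = r (n + 1) x := by
    rw [← (h.step n).factor, hw, (h.step n).merge x hxn]
  refine ⟨w, ⟨n + 1, hw'.symm⟩, ?_⟩
  rw [h.positionDiff_eq hw'.symm, position, position, if_neg hn,
    if_pos (by rw [hw', hw, hx']), position_eq_zero hmin]
  have hp' : (position r n w : ℤ) + 1 = 2 ^ n := mod_cast hp
  push_cast
  linarith

theorem infinite_class (h : IsTower e r s ξ) {x : X} (hx : ∀ n, s n (r n x) ≠ r n x) :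
    {y | ∃ n, r n x = r n y}.Infinite := by
  have hu : ∀ n, ∃ u, r n u = u ∧ r (n + 1) u = r (n + 1) x ∧ r (n + 1) u ≠ u := by
    intro n
    by_cases h1 : r (n + 1) x = r n x
    · have := (h.step n).merge _ ((h.stage n).idem x)
      rw [(h.step n).factor] at this
      refine ⟨s n (r n x), (h.step n).swap _ ((h.stage n).idem x), this, ?_⟩
      rw [this, h1]
      exact (hx n).symm
    · exact ⟨r n x, (h.stage n).idem x, (h.step n).factor x, by rwa [(h.step n).factor]⟩
  choose u hu1 hu2 hu3 using hu
  refine Set.infinite_of_injective_forall_mem (f := u) ?_ fun n => ⟨n + 1, (hu2 n).symm⟩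
  have : ∀ n m, n < m → u n ≠ u m := by
    intro n m hnm heq
    refine hu3 n (h.fixed_of_le hnm ?_)
    rw [heq, hu1]
  intro n m hnm
  rcases lt_trichotomy n m with hlt | heq | hgt
  · exact absurd hnm (this n m hlt)
  · exact heq
  · exact absurd hnm.symm (this m n hgt)

end IsTower

theorem IsSeparating.exists_equiv_and_invariant [Countable G] [MeasurableConstSMul G X]
    {φ : X → ℝ} (hφ : IsSeparating G φ) (haper : ∀ x : X, (orbit G x).Infinite) :
    ∃ (T : X ≃ X) (f : X → ℕ → ℕ), (∀ g : G, MeasurableSet {x | T x = g • x}) ∧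
      (∀ (x : X) (n : ℤ), n ≠ 0 → (T ^ n : Equiv.Perm X) x ≠ x) ∧ Measurable f ∧
      ∀ x y, (y ∈ orbit G x ∧ f x = f y) ↔ ∃ n : ℤ, (T ^ n : Equiv.Perm X) x = y := by
  classical
  obtain ⟨e, he⟩ := exists_surjective_nat G
  obtain ⟨r, s, ξ, h⟩ := exists_isTower hφ e
  have hr : ∀ n, IsOrbitMap G (r n) := fun n => (h.stage n).orb
  let B : Set X := {x | ∃ y ∈ orbit G x, ∃ n, s n (r n y) = r n y}
  have hBm : MeasurableSet B := by
    have : B = ⋃ g : G, ⋃ n, {x | s n (r n (g • x)) = r n (g • x)} := by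
      ext x
      simp only [B, Set.mem_ofPred_eq, Set.mem_iUnion]
      constructor
      · rintro ⟨_, ⟨g, rfl⟩, n, hn⟩
        exact ⟨g, n, hn⟩
      · rintro ⟨g, n, hn⟩
        exact ⟨_, mem_orbit x g, n, hn⟩
    rw [this]
    exact MeasurableSet.iUnion fun g => MeasurableSet.iUnion fun n => hφ.measurableSet_eq
      ((h.step n).orb.comp ((hr n).comp (isOrbitMap_smul g))) ((hr n).comp (isOrbitMap_smul g))
  have hBorb : ∀ x y, y ∈ orbit G x → (x ∈ B ↔ y ∈ B) := by
    intro x y hxy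
    simp only [B, Set.mem_ofPred_eq, orbit_eq_iff.2 hxy]
  have hgood : ∀ x, x ∉ B → ∀ y ∈ orbit G x, ∀ n, s n (r n y) ≠ r n y :=
    fun x hx y hy n hn => hx ⟨y, hy, n, hn⟩
  let f : X → ℕ → ℕ := fun x => if x ∈ B then 0 else fun n => ξ n x
  have hf : Measurable f :=
    Measurable.ite hBm measurable_const (measurable_pi_lambda _ fun n => (h.stage n).meas)
  let R : X → X → Prop := fun x y => y ∈ orbit G x ∧ f x = f y
  have hR : Equivalence R :=
    ⟨fun x => ⟨mem_orbit_self x, rfl⟩, fun h => ⟨mem_orbit_symm.1 h.1, h.2.symm⟩,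
      fun h h' => ⟨mem_orbit_trans h.1 h'.1, h.2.trans h'.2⟩⟩
  have hRbad : ∀ x, x ∈ B → ∀ y, R x y ↔ y ∈ orbit G x := by
    refine fun x hx y => ⟨fun h => h.1, fun hy => ⟨hy, ?_⟩⟩
    simp only [f, if_pos hx, if_pos ((hBorb x y hy).1 hx)]
  have hRgood : ∀ x, x ∉ B → ∀ y, R x y ↔ ∃ n, r n x = r n y := by
    intro x hx y
    have hf' : y ∈ orbit G x → (f x = f y ↔ ∃ n, r n x = r n y) := by
      intro hy
      simp only [f, if_neg hx, if_neg (mt (hBorb x y hy).2 hx), funext_iff,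
        h.exists_eq_iff he hy]
    refine ⟨fun H => (hf' H.1).1 H.2, fun H => ?_⟩
    have hy := H.elim fun n hn => h.mem_orbit_of_eq hn
    exact ⟨hy, (hf' hy).2 H⟩
  have hRm : ∀ g : G, MeasurableSet {x | R x (g • x)} := by
    intro g
    simp only [R, mem_orbit, true_and]
    exact measurableSet_eq_fun hf (hf.comp (measurable_const_smul g))
  have hRinf : ∀ x, {y | R x y}.Infinite := by
    intro x
    by_cases hx : x ∈ B
    · simp only [hRbad x hx]
      exact haper x
    · simp only [hRgood x hx]
      exact h.infinite_class (hgood x hx x (mem_orbit_self x))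
  let V : Bool ⊕ (ℕ × ℕ) → Set X := Sum.elim
    (fun b => Bᶜ ∩ if b then {x | ∀ n, r (n + 1) x = r n x} else {x | ∀ n, r (n + 1) x ≠ r n x})
    (fun q => {x | r q.1 x = x ∧ s q.1 x = x ∧ ξ (q.1 + 1) x = q.2})
  have hV : ∀ i, MeasurableSet (V i) := by
    have hm : ∀ n, MeasurableSet {x | r (n + 1) x = r n x} := fun n =>
      hφ.measurableSet_eq (hr _) (hr _)
    rintro ((_ | _) | ⟨n, j⟩)
    · refine hBm.compl.inter ?_
      simp only [Bool.false_eq_true, if_false, Set.ofPred_forall]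
      exact MeasurableSet.iInter fun n => (hm n).compl
    · refine hBm.compl.inter ?_
      simp only [if_true, Set.ofPred_forall]
      exact MeasurableSet.iInter hm
    · exact (hφ.measurableSet_eq (hr n) isOrbitMap_id).inter
        ((hφ.measurableSet_eq (h.step n).orb isOrbitMap_id).inter
        ((h.stage (n + 1)).meas (measurableSet_singleton j)))
  have hV1 : ∀ i x y, R x y → x ∈ V i → y ∈ V i → x = y := by
    rintro ((_ | _) | ⟨n, j⟩) x y hxy hx hy
    · obtain ⟨n, hn⟩ := (hRgood x hx.1 y).1 hxy
      refine h.eq_of_position_eq hn ?_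
      have h1 := position_add_one_eq (n := n) fun i _ => hx.2 i
      have h2 := position_add_one_eq (n := n) fun i _ => hy.2 i
      omega
    · obtain ⟨n, hn⟩ := (hRgood x hx.1 y).1 hxy
      refine h.eq_of_position_eq hn ?_
      rw [position_eq_zero fun i _ => hx.2 i, position_eq_zero fun i _ => hy.2 i]
    · exact (h.step n).maximal x y hxy.1 (hx.2.2.trans hy.2.2.symm) hx.1 hy.1 hx.2.1 hy.2.1
  obtain ⟨ρ, hYm, hadd, hinj, hsurj, hρm⟩ :=
    exists_cocycle_of_partial_transversals hR (fun x y hxy => hxy.1) hRm hRinf hV hV1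
  let Y : X → Prop := fun x => ∃ i y, R x y ∧ y ∈ V i
  have hYR : ∀ x y, R x y → (Y x ↔ Y y) := fun x y hxy =>
    ⟨fun ⟨i, z, hz, hzV⟩ => ⟨i, z, hR.trans (hR.symm hxy) hz, hzV⟩,
      fun ⟨i, z, hz, hzV⟩ => ⟨i, z, hR.trans hxy hz, hzV⟩⟩
  have hYB : ∀ x, ¬ Y x → x ∉ B := by
    rintro x hx ⟨y, hy, n, hn⟩
    refine hx ⟨Sum.inr (n, ξ (n + 1) (r n y)), r n y, ?_, (h.stage n).idem y, hn, rfl⟩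
    exact (hRbad x ⟨y, hy, n, hn⟩ _).2 (mem_orbit_trans hy ((hr n).2 y))
  let τ : X → X → ℤ := fun x y => if Y x then ρ x y else positionDiff r x y
  suffices h : ∃ T : X ≃ X, (∀ g : G, MeasurableSet {x | T x = g • x}) ∧
      (∀ (x : X) (n : ℤ), n ≠ 0 → (T ^ n : Equiv.Perm X) x ≠ x) ∧
      ∀ x y, R x y ↔ ∃ n : ℤ, (T ^ n : Equiv.Perm X) x = y by
    obtain ⟨T, hT1, hT2, hT3⟩ := h
    exact ⟨T, f, hT1, hT2, hf, hT3⟩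
  refine exists_equiv_of_cocycle hR (ρ := τ) ?_ ?_ ?_ ?_ ?_
  · intro x y z hxy hyz
    by_cases hx : Y x
    · simp only [τ, hx, (hYR x y hxy).1 hx, if_true, hadd x y z]
    · have hy := mt (hYR x y hxy).2 hx
      simp only [τ, hx, hy, if_false]
      exact h.positionDiff_add ((hRgood x (hYB x hx) y).1 hxy) ((hRgood y (hYB y hy) z).1 hyz)
  · intro x y hxy h0
    by_cases hx : Y x
    · exact hinj x y hx hxy (by simpa only [τ, hx, if_true] using h0)
    · exact h.eq_of_positionDiff_eq_zero ((hRgood x (hYB x hx) y).1 hxy)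
        (by simpa only [τ, hx, if_false] using h0)
  · intro x
    by_cases hx : Y x
    · simpa only [τ, hx, if_true] using hsurj x 1 hx
    · simp only [τ, hx, if_false, hRgood x (hYB x hx)]
      refine h.exists_positionDiff_eq_one (hgood x (hYB x hx) x (mem_orbit_self x)) ?_
      by_contra hne
      push Not at hne
      exact hx ⟨Sum.inl false, x, hR.refl x, hYB x hx, hne⟩
  · intro x
    by_cases hx : Y x
    · simpa only [τ, hx, if_true] using hsurj x (-1) hx
    · simp only [τ, hx, if_false, hRgood x (hYB x hx)]
      refine h.exists_positionDiff_eq_neg_one (hgood x (hYB x hx)) ?_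
      by_contra hne
      push Not at hne
      exact hx ⟨Sum.inl true, x, hR.refl x, hYB x hx, hne⟩
  · intro g
    have hsplit : {x | R x (g • x) ∧ τ x (g • x) = 1} =
        ({x | R x (g • x)} ∩ ({x | Y x} ∩ {x | ρ x (g • x) = 1})) ∪
        ({x | Y x}ᶜ ∩ ⋃ n, ({x | r n x = r n (g • x)} ∩
          {x | (position r n (g • x) : ℤ) - position r n x = 1})) := by
      ext x
      by_cases hx : Y x
      · simp [τ, hx]
      · simp only [τ, hx, hRgood x (hYB x hx), Set.mem_ofPred_eq, Set.mem_union,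
          Set.mem_inter_iff, Set.mem_compl_iff, Set.mem_iUnion, if_false, false_and, and_false,
          false_or, not_false_eq_true, true_and]
        constructor
        · rintro ⟨⟨n, hn⟩, h1⟩
          exact ⟨n, hn, by rwa [h.positionDiff_eq hn] at h1⟩
        · rintro ⟨n, hn, h1⟩
          exact ⟨⟨n, hn⟩, by rwa [h.positionDiff_eq hn]⟩
    rw [hsplit]
    refine ((hRm g).inter (hYm.inter (hρm g))).union (hYm.compl.inter
      (MeasurableSet.iUnion fun n => MeasurableSet.inter ?_ ?_))
    · exact hφ.measurableSet_eq (hr n) ((hr n).comp (isOrbitMap_smul g))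
    · have hp : Measurable fun x => (position r n x : ℤ) :=
        (measurable_of_countable _).comp (measurable_position hφ hr n)
      exact measurableSet_eq_fun ((hp.comp (measurable_const_smul g)).sub hp) measurable_const

/-- A countably generated σ-algebra that separates points within orbits admits a separating
function. -/
theorem exists_isSeparating {C : ℕ → Set X}
    (hC : ‹MeasurableSpace X› = MeasurableSpace.generateFrom (Set.range C))
    (hcb : ∀ x y : X, y ∈ orbit G x → x ≠ y → ∃ A : Set X, MeasurableSet A ∧ x ∈ A ∧ y ∉ A) :
    ∃ φ : X → ℝ, IsSeparating G φ := by
  let ψ : X → ℕ → Prop := fun x n => x ∈ C n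
  have hψ : Measurable ψ := measurable_pi_lambda _ fun n =>
    measurableSet_setOfPred.1 (hC ▸ MeasurableSpace.measurableSet_generateFrom ⟨n, rfl⟩)
  have hle : MeasurableSpace.generateFrom (Set.range C) ≤ MeasurableSpace.comap ψ ⊤ := by
    refine MeasurableSpace.generateFrom_le ?_
    rintro _ ⟨n, rfl⟩
    exact ⟨{p | p n}, trivial, rfl⟩
  refine ⟨fun x => embeddingReal (ℕ → Prop) (ψ x),
    (measurableEmbedding_embeddingReal _).measurable.comp hψ, fun x y hxy h => ?_⟩
  have hxy' : ψ x = ψ y := (measurableEmbedding_embeddingReal _).injective h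
  by_contra hne
  obtain ⟨A, hA, hxA, hyA⟩ := hcb x y hxy hne
  rw [hC] at hA
  obtain ⟨A', -, rfl⟩ := hle _ hA
  exact hyA (show ψ y ∈ A' from hxy' ▸ hxA)

end OrbitMaps

theorem expressible_of_measurableSet_eq_smul {G X : Type*} [Group G] [Countable G] [MulAction G X]
    [F : MeasurableSpace X] {T : X ≃ X} (hT : ∀ x, T x ∈ MulAction.orbit G x)
    (hm : ∀ g : G, MeasurableSet {x | T x = g • x}) : Expressible G F T := by
  obtain ⟨ι, hι⟩ := Countable.exists_injective_nat G
  refine ⟨fun g => {x | T x = g • x} ∩ ⋂ g', ⋂ (_ : ι g' < ι g), {x | T x = g' • x}ᶜ,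
    fun g => (hm g).inter (MeasurableSet.iInter fun g' => MeasurableSet.iInter fun _ =>
      (hm g').compl), ?_, ?_, fun g x hx => hx.1⟩
  · intro g g' hne
    refine Set.disjoint_left.2 fun x hx hx' => ?_
    simp only [Set.mem_inter_iff, Set.mem_iInter, Set.mem_compl_iff] at hx hx'
    rcases lt_trichotomy (ι g) (ι g') with h | h | h
    · exact hx'.2 g h hx.1
    · exact hne (hι h)
    · exact hx.2 g' h hx'.1
  · refine Set.eq_univ_of_forall fun x => ?_
    have hne : {g : G | T x = g • x}.Nonempty := (hT x).imp fun g hg => hg.symm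
    simp only [Set.mem_iUnion, Set.mem_inter_iff, Set.mem_iInter, Set.mem_compl_iff]
    refine ⟨Function.argminOn ι _ hne, Function.argminOn_mem ι _ hne, fun g' hlt hg' => ?_⟩
    exact Function.not_lt_argminOn ι _ hg' hlt

/-- **A smooth division into hyperfinite pieces, full group form**: if `G ↷ X` is an
aperiodic Borel action of a countable group on a standard Borel space and `F` is a countably
generated class-bijective `G`-invariant sub-σ-algebra, then there are an `F`-expressible
element `T` of the full group `[E_G^X]` with all orbits infinite and an `F`-measurable
`T`-invariant Borel function `f : X → [0, 1]` such that two points lie in the same `G`-orbit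
and have equal `f`-values exactly when they lie in the same `T`-orbit. -/
theorem exists_expressible_aperiodic_with_invariant_function
    {G X : Type*} [Group G] [Countable G]
    (F : MeasurableSpace X) [mX : MeasurableSpace X] [StandardBorelSpace X]
    [MulAction G X]
    (hmeas : ∀ g : G, Measurable (fun x : X => g • x))
    (haper : ∀ x : X, (MulAction.orbit G x).Infinite)
    (hFle : F ≤ mX)
    (hFinv : ∀ (g : G) (s : Set X), MeasurableSet[F] s →
      MeasurableSet[F] ((fun x : X => g • x) ⁻¹' s))
    (hFctbl : ∃ C : ℕ → Set X, F = MeasurableSpace.generateFrom (Set.range C))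
    (hFcb : ∀ x y : X, y ∈ MulAction.orbit G x → x ≠ y →
      ∃ A : Set X, MeasurableSet[F] A ∧ x ∈ A ∧ y ∉ A) :
    ∃ (T : X ≃ X) (f : X → ℝ),
      Measurable T ∧ Measurable T.symm ∧
      (∀ x : X, T x ∈ MulAction.orbit G x) ∧
      Expressible G F T ∧
      (∀ (x : X) (n : ℤ), n ≠ 0 → (T ^ n : Equiv.Perm X) x ≠ x) ∧
      Measurable[F] f ∧
      (∀ x : X, f x ∈ Set.Icc (0 : ℝ) 1) ∧
      (∀ x : X, f (T x) = f x) ∧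
      ∀ x y : X, (y ∈ MulAction.orbit G x ∧ f x = f y) ↔
        ∃ n : ℤ, (T ^ n : Equiv.Perm X) x = y := by
  obtain ⟨C, hC⟩ := hFctbl
  obtain ⟨φ, hφ⟩ := @exists_isSeparating G X _ _ F C hC hFcb
  obtain ⟨T, f, hTF, hper, hf, hR⟩ :=
    @IsSeparating.exists_equiv_and_invariant G X _ _ F _ (@MeasurableConstSMul.mk G X _ F
      fun g s hs => hFinv g s hs) φ hφ haper
  have hT : ∀ x, T x ∈ MulAction.orbit G x ∧ f x = f (T x) := fun x =>
    (hR x (T x)).2 ⟨1, by rw [zpow_one]⟩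
  have : MeasurableConstSMul G X := ⟨hmeas⟩
  have hTm : ∀ g : G, MeasurableSet[mX] {x | T x = g • x} := fun g => hFle _ (hTF g)
  let j : (ℕ → ℕ) → ℝ := fun a => unitInterval.sigmoid (embeddingReal (ℕ → ℕ) a)
  have hj := measurableEmbedding_sigmoid_comp_embeddingReal (ℕ → ℕ)
  have hjm : Measurable j := measurable_subtype_coe.comp hj.measurable
  have hji : Function.Injective j := Subtype.coe_injective.comp hj.injective
  refine ⟨T, fun x => j (f x), ?_, ?_, fun x => (hT x).1, ?_, hper, hjm.comp hf,
    fun x => (unitInterval.sigmoid _).2, fun x => congrArg j (hT x).2.symm, fun x y => ?_⟩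
  · exact (isOrbitMap_of_measurableSet_eq_smul (fun x => (hT x).1) hTm).1
  · refine (isOrbitMap_of_measurableSet_eq_smul (G := G) (u := T.symm) (fun y => ?_)
      fun g => ?_).1
    · simpa using MulAction.mem_orbit_symm.1 (hT (T.symm y)).1
    · have : {y | T.symm y = g • y} = (fun y => g • y) ⁻¹' {x | T x = g⁻¹ • x} := by
        ext y
        simp only [Set.mem_ofPred_eq, Set.mem_preimage, inv_smul_smul, Equiv.symm_apply_eq]
        exact eq_comm
      rw [this]
      exact hmeas g (hTm g⁻¹)
  · exact @expressible_of_measurableSet_eq_smul G X _ _ _ F T (fun x => (hT x).1) hTF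
  · rw [← hR x y, hji.eq_iff]
end

section
/- Let G be a countable group, let G ↷ X be an aperiodic Borel action on a standard Borel space, let A ⊆ X be Borel, and let 0 ≤ r. If ν(A) ≥ r for every G-invariant ergodic Borel probability measure ν on X, then there is a Borel set B ⊆ A with ν(B) = r for every G-invariant ergodic Borel probability measure ν on X. -/
open MeasureTheory

/-- `ν` is a `G`-invariant ergodic Borel probability measure. -/
def IsErgodicInvariant (G : Type*) {X : Type*} [Group G] [MulAction G X] [MeasurableSpace X]
    (ν : Measure X) : Prop :=
  IsProbabilityMeasure ν ∧
    (∀ g : G, MeasurePreserving (fun x : X => g • x) ν ν) ∧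
    ∀ s : Set X, MeasurableSet s → (∀ g : G, (fun x : X => g • x) ⁻¹' s = s) →
      ν s = 0 ∨ ν s = 1

section Matching

variable {G X : Type*} [Group G] [MulAction G X] [MeasurableSpace X]

/-- Greedy matching: a countable list of partial matchings `x ↦ g k • x` from `U k` to `V k` can be
exhausted inside `D`, using each point at most once. -/
theorem exists_greedy_matching (hmeas : ∀ g : G, Measurable (fun x : X => g • x))
    (g : ℕ → G) {U V : ℕ → Set X} (hU : ∀ k, MeasurableSet (U k)) (hV : ∀ k, MeasurableSet (V k))
    (hUV : ∀ k, Disjoint (U k) (V k)) {D : Set X} (hD : MeasurableSet D) :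
    ∃ Y Z : Set X, MeasurableSet Y ∧ MeasurableSet Z ∧ Y ⊆ D ∩ ⋃ k, U k ∧ Z ⊆ D ∩ ⋃ k, V k ∧
      Disjoint Y Z ∧
      (∀ ν : Measure X, (∀ h : G, MeasurePreserving (fun x : X => h • x) ν ν) → ν Y = ν Z) ∧
      ∀ k, ∀ x ∈ D \ (Y ∪ Z), g k • x ∈ D \ (Y ∪ Z) → x ∈ U k → g k • x ∉ V k := by
  let M : ℕ → Set X → Set X := fun k S => (S ∩ U k) ∩ (fun x => g k • x) ⁻¹' (S ∩ V k)
  let N : ℕ → Set X → Set X := fun k S => (S ∩ V k) ∩ (fun x => (g k)⁻¹ • x) ⁻¹' (S ∩ U k)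
  let R : ℕ → Set X := fun n => Nat.rec D (fun k S => S \ (M k S ∪ N k S)) n
  have hR : ∀ k, R (k + 1) = R k \ (M k (R k) ∪ N k (R k)) := fun k => rfl
  have hM : ∀ k S, MeasurableSet S → MeasurableSet (M k S) := fun k S hS =>
    (hS.inter (hU k)).inter (hmeas _ (hS.inter (hV k)))
  have hN : ∀ k S, MeasurableSet S → MeasurableSet (N k S) := fun k S hS =>
    (hS.inter (hV k)).inter (hmeas _ (hS.inter (hU k)))
  have hRm : ∀ k, MeasurableSet (R k) := by
    intro k
    induction k with
    | zero => exact hD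
    | succ k ih => rw [hR]; exact ih.diff ((hM _ _ ih).union (hN _ _ ih))
  have hanti : Antitone R := antitone_nat_of_succ_le fun k => by rw [hR]; exact Set.sdiff_subset
  have hMR : ∀ k, M k (R k) ⊆ R k := fun k x hx => hx.1.1
  have hNR : ∀ k, N k (R k) ⊆ R k := fun k x hx => hx.1.1
  have hMN : ∀ k, Disjoint (M k (R k)) (N k (R k)) := fun k =>
    (hUV k).mono (fun x hx => hx.1.2) (fun x hx => hx.1.2)
  have hlt : ∀ i j, i < j → Disjoint (M i (R i) ∪ N i (R i)) (R j) := fun i j hij => by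
    refine Set.disjoint_right.2 fun x hx => ?_
    have := hanti (Nat.succ_le_of_lt hij) hx
    exact (hR i ▸ this : x ∈ R i \ (M i (R i) ∪ N i (R i))).2
  have hMd : Pairwise (Function.onFun Disjoint fun k => M k (R k)) :=
    (pairwise_disjoint_on _).2 fun i j hij =>
      (hlt i j hij).mono Set.subset_union_left (hMR j)
  have hNd : Pairwise (Function.onFun Disjoint fun k => N k (R k)) :=
    (pairwise_disjoint_on _).2 fun i j hij =>
      (hlt i j hij).mono Set.subset_union_right (hNR j)
  refine ⟨⋃ k, M k (R k), ⋃ k, N k (R k), .iUnion fun k => hM _ _ (hRm k),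
    .iUnion fun k => hN _ _ (hRm k), ?_, ?_, ?_, ?_, ?_⟩
  · exact Set.iUnion_subset fun k x hx =>
      ⟨hanti (Nat.zero_le k) (hMR k hx), Set.mem_iUnion.2 ⟨k, hx.1.2⟩⟩
  · exact Set.iUnion_subset fun k x hx =>
      ⟨hanti (Nat.zero_le k) (hNR k hx), Set.mem_iUnion.2 ⟨k, hx.1.2⟩⟩
  · refine Set.disjoint_iUnion_left.2 fun i => Set.disjoint_iUnion_right.2 fun j => ?_
    rcases lt_trichotomy i j with h | rfl | h
    · exact (hlt i j h).mono Set.subset_union_left (hNR j)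
    · exact hMN i
    · exact ((hlt j i h).mono Set.subset_union_right (hMR i)).symm
  · intro ν hν
    rw [measure_iUnion hMd fun k => hM _ _ (hRm k), measure_iUnion hNd fun k => hN _ _ (hRm k)]
    refine tsum_congr fun k => ?_
    rw [← (hν (g k)).measure_preimage (hN _ _ (hRm k)).nullMeasurableSet]
    congr 1
    ext x
    simp only [M, N, Set.mem_inter_iff, Set.mem_preimage, inv_smul_smul]
    tauto
  · rintro k x ⟨hxD, hx⟩ ⟨hyD, hy⟩ hxU hyV
    have key : ∀ z ∈ D, z ∉ (⋃ k, M k (R k)) ∪ ⋃ k, N k (R k) → ∀ n, z ∈ R n := by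
      intro z hzD hz n
      induction n with
      | zero => exact hzD
      | succ n ih =>
        rw [hR]
        refine ⟨ih, fun h => hz ?_⟩
        exact h.imp (fun h => Set.mem_iUnion.2 ⟨n, h⟩) (fun h => Set.mem_iUnion.2 ⟨n, h⟩)
    exact hx (Or.inl (Set.mem_iUnion.2 ⟨k, ⟨key x hxD hx k, hxU⟩, key _ hyD hy k, hyV⟩))

/-- A Borel set meeting every orbit of an aperiodic action at most once is null for every finite
invariant measure. -/
theorem measure_eq_zero_of_partial_transversal [Countable G] [MeasurableEq X]
    (hmeas : ∀ g : G, Measurable (fun x : X => g • x))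
    (haper : ∀ x : X, (MulAction.orbit G x).Infinite)
    {S : Set X} (hS : MeasurableSet S) (hinj : ∀ x ∈ S, ∀ h : G, h • x ∈ S → h • x = x)
    (ν : Measure X) [IsFiniteMeasure ν]
    (hν : ∀ h : G, MeasurePreserving (fun x : X => h • x) ν ν) : ν S = 0 := by
  obtain ⟨g, hg⟩ := exists_surjective_nat G
  let T : ℕ → Set X := fun i => S ∩ {x | ∀ j < i, g i • x ≠ g j • x}
  have hT : ∀ i, MeasurableSet (T i) := fun i => by
    refine hS.inter ?_
    simp only [Set.ofPred_forall]
    exact .iInter fun j => .iInter fun _ =>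
      (measurableSet_eq_fun (hmeas (g i)) (hmeas (g j))).compl
  let W : ℕ → Set X := fun i => (fun x => (g i)⁻¹ • x) ⁻¹' T i
  have hW : ∀ i, MeasurableSet (W i) := fun i => hmeas _ (hT i)
  have hWd : Pairwise (Function.onFun Disjoint W) := by
    refine (pairwise_disjoint_on _).2 fun i j hij => Set.disjoint_left.2 fun y hi hj => ?_
    have hi' : (g i)⁻¹ • y ∈ T i := hi
    have hj' : (g j)⁻¹ • y ∈ T j := hj
    have e := hinj _ hj'.1 ((g i)⁻¹ * g j) (by
      rw [mul_smul, smul_inv_smul]; exact hi'.1)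
    rw [mul_smul, smul_inv_smul] at e
    refine hj'.2 i hij ?_
    rw [smul_inv_smul, ← e, smul_inv_smul]
  have hsum : ∑' i, ν (T i) ≠ ⊤ := by
    have : ∑' i, ν (T i) = ν (⋃ i, W i) := by
      rw [measure_iUnion hWd hW]
      exact tsum_congr fun i => ((hν _).measure_preimage (hT i).nullMeasurableSet).symm
    rw [this]
    exact measure_ne_top _ _
  have hlim : ∀ x ∈ S, ∃ᶠ i in Filter.atTop, x ∈ T i := by
    intro x hx
    rw [Filter.frequently_atTop]
    intro n
    by_contra! h
    have hsub : MulAction.orbit G x ⊆ (fun j => g j • x) '' Set.Iio n := by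
      have : ∀ i, ∃ j < n, g j • x = g i • x := by
        intro i
        induction i using Nat.strong_induction_on with
        | _ i ih =>
          by_cases hin : i < n
          · exact ⟨i, hin, rfl⟩
          · have hxT := h i (not_lt.1 hin)
            have : ∃ j < i, g i • x = g j • x := by
              by_contra! h'
              exact hxT ⟨hx, h'⟩
            obtain ⟨j, hj, e⟩ := this
            obtain ⟨l, hl, e'⟩ := ih j hj
            exact ⟨l, hl, e'.trans e.symm⟩
      rintro _ ⟨h, rfl⟩
      obtain ⟨i, rfl⟩ := hg h
      obtain ⟨j, hj, e⟩ := this i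
      exact ⟨j, hj, e⟩
    exact haper x (((Set.finite_Iio n).image _).subset hsub)
  exact measure_mono_null hlim (measure_setOfPred_frequently_eq_zero hsum)

/-- For an aperiodic Borel action, every Borel set splits into two halves of equal measure for all
finite invariant measures simultaneously. -/
theorem exists_borel_half [Countable G] [StandardBorelSpace X]
    (hmeas : ∀ g : G, Measurable (fun x : X => g • x))
    (haper : ∀ x : X, (MulAction.orbit G x).Infinite) {D : Set X} (hD : MeasurableSet D) :
    ∃ Y ⊆ D, MeasurableSet Y ∧ ∀ ν : Measure X, IsFiniteMeasure ν →
      (∀ h : G, MeasurePreserving (fun x : X => h • x) ν ν) →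
        ν Y = ν D / 2 ∧ ν (D \ Y) = ν D / 2 := by
  obtain ⟨S, hS, hsep⟩ := exists_seq_separating X MeasurableSet.univ Set.univ
  obtain ⟨g, hg⟩ := exists_surjective_nat G
  obtain ⟨Y, Z, hY, hZ, hYD, hZD, hYZ, hν, hmax⟩ := exists_greedy_matching hmeas
    (fun k => g k.unpair.1) (fun k => hS k.unpair.2) (fun k => (hS k.unpair.2).compl)
    (fun k => disjoint_compl_right) hD
  have hsub : Y ∪ Z ⊆ D :=
    Set.union_subset (fun x hx => (hYD hx).1) (fun x hx => (hZD hx).1)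
  have hmem : ∀ x ∈ D \ (Y ∪ Z), ∀ h : G, h • x ∈ D \ (Y ∪ Z) → ∀ n, x ∈ S n → h • x ∈ S n := by
    intro x hx h hy n hxn
    obtain ⟨i, rfl⟩ := hg h
    by_contra hn
    have := hmax (Nat.pair i n) x hx
    simp only [Nat.unpair_pair] at this
    exact this hy hxn hn
  refine ⟨Y, fun x hx => (hYD hx).1, hY, fun ν _ hinv => ?_⟩
  have hnull : ν (D \ (Y ∪ Z)) = 0 := by
    refine measure_eq_zero_of_partial_transversal hmeas haper (hD.diff (hY.union hZ)) ?_ ν hinv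
    intro x hx h hy
    refine hsep _ (Set.mem_univ _) _ (Set.mem_univ _) fun n =>
      ⟨fun hn => ?_, fun hn => hmem x hx h hy n hn⟩
    have := hmem _ hy h⁻¹ (by rwa [inv_smul_smul]) n hn
    rwa [inv_smul_smul] at this
  have hDY : ν D = ν Y + ν Y := by
    rw [← measure_sdiff_add_inter D (hY.union hZ), hnull, zero_add, Set.inter_eq_right.2 hsub,
      measure_union hYZ hZ, hν ν hinv]
  have hhalf : ν Y = ν D / 2 := by
    rw [hDY, ← two_mul, mul_comm, ENNReal.mul_div_cancel_right two_ne_zero ENNReal.ofNat_ne_top]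
  refine ⟨hhalf, ?_⟩
  rw [measure_sdiff (fun x hx => (hYD hx).1) hY.nullMeasurableSet (measure_ne_top _ _), ← hhalf, hDY,
    ENNReal.add_sub_cancel_right (measure_ne_top _ _)]

/-- An aperiodic Borel action admits Borel sets whose measure is any prescribed number in `[0, 1]`
for all invariant probability measures simultaneously. -/
theorem exists_borel_measure_eq [Countable G] [StandardBorelSpace X]
    (hmeas : ∀ g : G, Measurable (fun x : X => g • x))
    (haper : ∀ x : X, (MulAction.orbit G x).Infinite) {r : ENNReal} (hr : r ≤ 1) :
    ∃ C : Set X, MeasurableSet C ∧ ∀ ν : Measure X, IsProbabilityMeasure ν →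
      (∀ h : G, MeasurePreserving (fun x : X => h • x) ν ν) → ν C = r := by
  let P : ℕ → Set X × Set X → Prop := fun n s =>
    MeasurableSet s.1 ∧ MeasurableSet s.2 ∧ Disjoint s.1 s.2 ∧
      ∃ c : ENNReal, c ≤ r ∧ r ≤ c + 2⁻¹ ^ n ∧ ∀ ν : Measure X, IsProbabilityMeasure ν →
        (∀ h : G, MeasurePreserving (fun x : X => h • x) ν ν) → ν s.1 = c ∧ ν s.2 = 2⁻¹ ^ n
  have h0 : P 0 (∅, Set.univ) := by
    refine ⟨.empty, .univ, Set.empty_disjoint _, 0, zero_le, by simpa using hr, ?_⟩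
    intro ν _ _
    simp
  have hstep : ∀ n s, P n s → ∃ t, P (n + 1) t ∧ s.1 ⊆ t.1 := by
    rintro n ⟨C, D⟩ ⟨hC, hD, hCD, c, hc, hc', hν⟩
    obtain ⟨Y, hYD, hY, hhalf⟩ := exists_borel_half hmeas haper hD
    have e : (2⁻¹ : ENNReal) ^ n / 2 = 2⁻¹ ^ (n + 1) := by rw [pow_succ, div_eq_mul_inv]
    have e' : (2⁻¹ : ENNReal) ^ (n + 1) + 2⁻¹ ^ (n + 1) = 2⁻¹ ^ n := by
      rw [← e, ENNReal.add_halves]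
    by_cases h : c + 2⁻¹ ^ (n + 1) ≤ r
    · refine ⟨(C ∪ Y, D \ Y), ⟨hC.union hY, hD.diff hY, ?_, c + 2⁻¹ ^ (n + 1), h, ?_, ?_⟩,
        Set.subset_union_left⟩
      · exact Set.disjoint_union_left.2 ⟨hCD.mono_right Set.sdiff_subset, Set.disjoint_sdiff_right⟩
      · rwa [add_assoc, e']
      · intro ν hp hinv
        obtain ⟨h1, h2⟩ := hν ν hp hinv
        obtain ⟨h3, h4⟩ := hhalf ν inferInstance hinv
        dsimp only at h1 h2 ⊢
        rw [measure_union (hCD.mono_right hYD) hY, h1, h3, h4, h2, e]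
        exact ⟨rfl, rfl⟩
    · refine ⟨(C, Y), ⟨hC, hY, hCD.mono_right hYD, c, hc, (not_le.1 h).le, ?_⟩, subset_rfl⟩
      intro ν hp hinv
      obtain ⟨h1, h2⟩ := hν ν hp hinv
      obtain ⟨h3, -⟩ := hhalf ν inferInstance hinv
      dsimp only at h1 h2 ⊢
      exact ⟨h1, by rw [h3, h2, e]⟩
  choose! F hF hF' using hstep
  let s : ℕ → Set X × Set X := fun n => Nat.rec (∅, Set.univ) F n
  have hs : ∀ n, P n (s n) := fun n => by
    induction n with
    | zero => exact h0
    | succ n ih => exact hF n _ ih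
  have hmono : Monotone fun n => (s n).1 := monotone_nat_of_le_succ fun n => hF' n _ (hs n)
  refine ⟨⋃ n, (s n).1, .iUnion fun n => (hs n).1, fun ν hp hinv => ?_⟩
  have hle : ∀ n, ν (s n).1 ≤ r ∧ r ≤ ν (s n).1 + 2⁻¹ ^ n := fun n => by
    obtain ⟨-, -, -, c, hc, hc', h⟩ := hs n
    rw [(h ν hp hinv).1]
    exact ⟨hc, hc'⟩
  refine le_antisymm ?_ ?_
  · rw [hmono.measure_iUnion]
    exact iSup_le fun n => (hle n).1
  · have hlim : Filter.Tendsto (fun n : ℕ => ν (⋃ n, (s n).1) + 2⁻¹ ^ n) Filter.atTop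
        (nhds (ν (⋃ n, (s n).1) + 0)) :=
      tendsto_const_nhds.add
        (ENNReal.tendsto_pow_atTop_nhds_zero_of_lt_one (by simp))
    rw [add_zero] at hlim
    refine ge_of_tendsto' hlim fun n => (hle n).2.trans ?_
    gcongr
    exact Set.subset_iUnion (fun n => (s n).1) n

end Matching

/-- If `G ↷ X` is an aperiodic Borel action on a standard Borel space, `A ⊆ X` is Borel and
`ν(A) ≥ r` for every invariant ergodic probability measure `ν`, then there is a Borel set
`B ⊆ A` with `ν(B) = r` for every invariant ergodic probability measure `ν`. -/
theorem exists_borel_subset_uniform_measure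
    {G X : Type*} [Group G] [Countable G] [MeasurableSpace X] [StandardBorelSpace X]
    [MulAction G X]
    (hmeas : ∀ g : G, Measurable (fun x : X => g • x))
    (haper : ∀ x : X, (MulAction.orbit G x).Infinite)
    (A : Set X) (hA : MeasurableSet A)
    (r : ℝ) (hr : 0 ≤ r)
    (hAr : ∀ ν : Measure X, IsErgodicInvariant G ν → ENNReal.ofReal r ≤ ν A) :
    ∃ B : Set X, MeasurableSet B ∧ B ⊆ A ∧
      ∀ ν : Measure X, IsErgodicInvariant G ν → ν B = ENNReal.ofReal r := by
  by_cases hne : ∃ ν : Measure X, IsErgodicInvariant G ν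
  swap
  · exact ⟨∅, .empty, Set.empty_subset _, fun ν hν => (hne ⟨ν, hν⟩).elim⟩
  have hr1 : ENNReal.ofReal r ≤ 1 := by
    obtain ⟨ν, hν⟩ := hne
    have := hν.1
    exact (hAr ν hν).trans prob_le_one
  obtain ⟨C, hC, hCr⟩ := exists_borel_measure_eq hmeas haper hr1
  obtain ⟨g, hg⟩ := exists_surjective_nat G
  obtain ⟨Y, Z, hY, hZ, hYA, hZC, -, hYZ, hmax⟩ := exists_greedy_matching hmeas g
    (fun _ => hA.diff hC) (fun _ => hC.diff hA)
    (fun _ => disjoint_sdiff_sdiff) MeasurableSet.univ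
  simp only [Set.iUnion_const, Set.univ_inter] at hYA hZC
  refine ⟨(A ∩ C) ∪ Y, (hA.inter hC).union hY,
    Set.union_subset Set.inter_subset_left (hYA.trans Set.sdiff_subset), fun ν hν => ?_⟩
  have hAν := hAr ν hν
  obtain ⟨hp, hinv, herg⟩ := hν
  have hBY : ν ((A ∩ C) ∪ Y) = ν (A ∩ C) + ν Y :=
    measure_union (Set.disjoint_left.2 fun x hx hxY => (hYA hxY).2 hx.2) hY
  have hBZ : ν ((C ∩ A) ∪ Z) = ν (C ∩ A) + ν Z :=
    measure_union (Set.disjoint_left.2 fun x hx hxZ => (hZC hxZ).2 hx.2) hZ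
  have hBr : ν ((A ∩ C) ∪ Y) = ν ((C ∩ A) ∪ Z) := by
    rw [hBY, hBZ, Set.inter_comm, hYZ ν hinv]
  have hCν := hCr ν hp hinv
  have hle : ν ((A ∩ C) ∪ Y) ≤ ENNReal.ofReal r := by
    rw [hBr, ← hCν]
    exact measure_mono (Set.union_subset Set.inter_subset_left (hZC.trans Set.sdiff_subset))
  refine le_antisymm hle ?_
  set C' := (C \ A) \ Z with hC'
  have hC'm : MeasurableSet C' := (hC.diff hA).diff hZ
  have hsat : MeasurableSet (⋃ h : G, (fun x : X => h • x) ⁻¹' C') :=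
    .iUnion fun h => hmeas h hC'm
  have hsatinv : ∀ k : G, (fun x : X => k • x) ⁻¹' (⋃ h : G, (fun x : X => h • x) ⁻¹' C') =
      ⋃ h : G, (fun x : X => h • x) ⁻¹' C' := by
    intro k
    ext x
    simp only [Set.mem_preimage, Set.mem_iUnion, smul_smul]
    exact (Group.mulRight_bijective k).surjective.exists
      (p := fun h : G => h • x ∈ C') |>.symm
  rcases herg _ hsat hsatinv with h0 | h1
  · have hC'0 : ν C' = 0 :=
      measure_mono_null (fun x hx => Set.mem_iUnion.2 ⟨1, by simpa using hx⟩) h0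
    rw [hBr, ← hCν]
    have hsub : C ⊆ ((C ∩ A) ∪ Z) ∪ C' := fun x hx => by
      by_cases x ∈ A <;> by_cases x ∈ Z <;> simp_all
    simpa [hC'0] using (measure_mono hsub).trans (measure_union_le (μ := ν) _ _)
  · have hae := (prob_compl_eq_zero_iff hsat).2 h1
    have hA'0 : ν ((A \ C) \ Y) = 0 := by
      refine measure_mono_null ?_ hae
      rintro x ⟨hxA, hxY⟩ hx
      obtain ⟨h, hh⟩ := Set.mem_iUnion.1 hx
      obtain ⟨k, rfl⟩ := hg h
      refine hmax k x ⟨trivial, ?_⟩ ⟨trivial, ?_⟩ hxA hh.1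
      · exact fun hxx => hxx.elim hxY fun hz => hxA.2 (hZC hz).1
      · exact fun hxx => hxx.elim (fun hy => hh.1.2 (hYA hy).1) hh.2
    have hsub : A ⊆ ((A ∩ C) ∪ Y) ∪ ((A \ C) \ Y) := fun x hx => by
      by_cases x ∈ C <;> by_cases x ∈ Y <;> simp_all
    refine hAν.trans ?_
    simpa [hA'0] using (measure_mono hsub).trans (measure_union_le (μ := ν) _ _)
end

section
/- Let G be a countable group, let G ↷ X be a Borel action on a standard Borel space, and let A, B ⊆ X be Borel sets with ν(A) = ν(B) for every G-invariant ergodic Borel probability measure ν on X. Then there exist Borel sets A' ⊆ A and B' ⊆ B and a Borel bijection φ : A' → B' such that φ(x) lies in the G-orbit of x for all x ∈ A', and ν(A \ A') = ν(B \ B') = 0 for every G-invariant ergodic Borel probability measure ν on X. -/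
open MeasureTheory

/-- The parts of `A` and `B` left unmatched after greedily matching along `e 0, …, e (n - 1)`. -/
def greedyRemainder {G X : Type*} [Group G] [MulAction G X] (e : ℕ → G) (A B : Set X) :
    ℕ → Set X × Set X
  | 0 => (A, B)
  | n + 1 =>
    let R := greedyRemainder e A B n
    (R.1 \ (fun x => e n • x) ⁻¹' R.2, R.2 \ (fun x => (e n)⁻¹ • x) ⁻¹' R.1)

/-- The points of `A` matched by `e n` at the `n`-th step of the greedy matching. -/
def greedyDomain {G X : Type*} [Group G] [MulAction G X] (e : ℕ → G) (A B : Set X) (n : ℕ) :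
    Set X :=
  (greedyRemainder e A B n).1 ∩ (fun x => e n • x) ⁻¹' (greedyRemainder e A B n).2

/-- The points of `B` matched by `e n` at the `n`-th step of the greedy matching. -/
def greedyRange {G X : Type*} [Group G] [MulAction G X] (e : ℕ → G) (A B : Set X) (n : ℕ) :
    Set X :=
  (greedyRemainder e A B n).2 ∩ (fun x => (e n)⁻¹ • x) ⁻¹' (greedyRemainder e A B n).1

section Greedy

variable {G X : Type*} [Group G] [MulAction G X] (e : ℕ → G) (A B : Set X)

theorem greedyRemainder_succ_fst (n : ℕ) :
    (greedyRemainder e A B (n + 1)).1 = (greedyRemainder e A B n).1 \ greedyDomain e A B n := by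
  simp [greedyRemainder, greedyDomain]

theorem greedyRemainder_succ_snd (n : ℕ) :
    (greedyRemainder e A B (n + 1)).2 = (greedyRemainder e A B n).2 \ greedyRange e A B n := by
  simp [greedyRemainder, greedyRange]

theorem greedyRange_eq_preimage (n : ℕ) :
    greedyRange e A B n = (fun x => (e n)⁻¹ • x) ⁻¹' greedyDomain e A B n := by
  ext x
  simp [greedyRange, greedyDomain, and_comm]

theorem smul_mem_greedyRange_iff (n : ℕ) (x : X) :
    e n • x ∈ greedyRange e A B n ↔ x ∈ greedyDomain e A B n := by
  simp [greedyRange_eq_preimage]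

theorem antitone_greedyRemainder_fst : Antitone fun n => (greedyRemainder e A B n).1 :=
  antitone_nat_of_succ_le fun n => by
    simpa only [greedyRemainder_succ_fst] using Set.sdiff_subset

theorem antitone_greedyRemainder_snd : Antitone fun n => (greedyRemainder e A B n).2 :=
  antitone_nat_of_succ_le fun n => by
    simpa only [greedyRemainder_succ_snd] using Set.sdiff_subset

theorem pairwise_disjoint_greedyDomain : Pairwise (Function.onFun Disjoint (greedyDomain e A B)) :=
  (pairwise_disjoint_on _).2 fun m n hmn => Set.disjoint_left.2 fun x hm hn => by
    have h := antitone_greedyRemainder_fst e A B (Nat.succ_le_of_lt hmn) hn.1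
    simp only [Nat.succ_eq_add_one, greedyRemainder_succ_fst] at h
    exact h.2 hm

theorem pairwise_disjoint_greedyRange : Pairwise (Function.onFun Disjoint (greedyRange e A B)) :=
  (pairwise_disjoint_on _).2 fun m n hmn => Set.disjoint_left.2 fun x hm hn => by
    have h := antitone_greedyRemainder_snd e A B (Nat.succ_le_of_lt hmn) hn.1
    simp only [Nat.succ_eq_add_one, greedyRemainder_succ_snd] at h
    exact h.2 hm

theorem mem_greedyRemainder_fst {x : X} (hx : x ∈ A \ ⋃ n, greedyDomain e A B n) (n : ℕ) :
    x ∈ (greedyRemainder e A B n).1 := by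
  induction n with
  | zero => exact hx.1
  | succ n ih =>
    rw [greedyRemainder_succ_fst]
    exact ⟨ih, fun h => hx.2 (Set.mem_iUnion_of_mem n h)⟩

theorem mem_greedyRemainder_snd {x : X} (hx : x ∈ B \ ⋃ n, greedyRange e A B n) (n : ℕ) :
    x ∈ (greedyRemainder e A B n).2 := by
  induction n with
  | zero => exact hx.1
  | succ n ih =>
    rw [greedyRemainder_succ_snd]
    exact ⟨ih, fun h => hx.2 (Set.mem_iUnion_of_mem n h)⟩

theorem smul_notMem_diff_iUnion_greedyRange (n : ℕ) {x : X}
    (hx : x ∈ A \ ⋃ n, greedyDomain e A B n) : e n • x ∉ B \ ⋃ n, greedyRange e A B n :=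
  fun h => hx.2 <| Set.mem_iUnion_of_mem n
    ⟨mem_greedyRemainder_fst e A B hx n, mem_greedyRemainder_snd e A B h n⟩

variable {A B} [MeasurableSpace X]

theorem measurableSet_greedyRemainder (hmeas : ∀ g : G, Measurable (fun x : X => g • x))
    (hA : MeasurableSet A) (hB : MeasurableSet B) (n : ℕ) :
    MeasurableSet (greedyRemainder e A B n).1 ∧ MeasurableSet (greedyRemainder e A B n).2 := by
  induction n with
  | zero => exact ⟨hA, hB⟩
  | succ n ih => exact ⟨ih.1.diff (hmeas _ ih.2), ih.2.diff (hmeas _ ih.1)⟩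

theorem measurableSet_greedyDomain (hmeas : ∀ g : G, Measurable (fun x : X => g • x))
    (hA : MeasurableSet A) (hB : MeasurableSet B) (n : ℕ) :
    MeasurableSet (greedyDomain e A B n) :=
  have h := measurableSet_greedyRemainder e hmeas hA hB n
  h.1.inter (hmeas _ h.2)

theorem measurableSet_greedyRange (hmeas : ∀ g : G, Measurable (fun x : X => g • x))
    (hA : MeasurableSet A) (hB : MeasurableSet B) (n : ℕ) :
    MeasurableSet (greedyRange e A B n) :=
  have h := measurableSet_greedyRemainder e hmeas hA hB n
  h.2.inter (hmeas _ h.1)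

theorem measure_iUnion_greedyDomain_eq (hmeas : ∀ g : G, Measurable (fun x : X => g • x))
    (hA : MeasurableSet A) (hB : MeasurableSet B) {ν : Measure X}
    (hν : ∀ g : G, MeasurePreserving (fun x : X => g • x) ν ν) :
    ν (⋃ n, greedyDomain e A B n) = ν (⋃ n, greedyRange e A B n) := by
  rw [measure_iUnion (pairwise_disjoint_greedyDomain e A B)
      (measurableSet_greedyDomain e hmeas hA hB),
    measure_iUnion (pairwise_disjoint_greedyRange e A B)
      (measurableSet_greedyRange e hmeas hA hB)]
  refine tsum_congr fun n => ?_
  rw [greedyRange_eq_preimage, (hν _).measure_preimage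
    (measurableSet_greedyDomain e hmeas hA hB n).nullMeasurableSet]

end Greedy

/-- Two Borel sets with disjoint saturations cannot both have positive measure for an ergodic
measure. -/
theorem IsErgodicInvariant.measure_eq_zero_or_of_forall_smul_notMem {G X : Type*} [Group G]
    [Countable G] [MulAction G X] [MeasurableSpace X]
    (hmeas : ∀ g : G, Measurable (fun x : X => g • x)) {ν : Measure X}
    (hν : IsErgodicInvariant G ν) {E F : Set X} (hE : MeasurableSet E)
    (hEF : ∀ g : G, ∀ x ∈ E, g • x ∉ F) : ν E = 0 ∨ ν F = 0 := by
  have := hν.1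
  set S : Set X := ⋃ g : G, (fun x => g • x) ⁻¹' E with hS
  have hSm : MeasurableSet S := .iUnion fun g => hmeas g hE
  have hinv : ∀ g : G, (fun x : X => g • x) ⁻¹' S = S := by
    intro g
    ext x
    simp only [hS, Set.mem_preimage, Set.mem_iUnion, smul_smul]
    exact (Group.mulRight_bijective g).surjective.exists
      (p := fun h : G => h • x ∈ E) |>.symm
  rcases hν.2.2 S hSm hinv with h | h
  · refine .inl (measure_mono_null (fun x hx => Set.mem_iUnion.2 ⟨1, ?_⟩) h)
    simpa using hx
  · refine .inr (measure_mono_null (t := Sᶜ) (fun x hx hxS => ?_) ((prob_compl_eq_zero_iff hSm).2 h))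
    obtain ⟨g, hg⟩ := Set.mem_iUnion.1 hxS
    exact hEF g⁻¹ _ hg (by simpa using hx)

/-- If `A, B ⊆ X` are Borel sets with `ν(A) = ν(B)` for every `G`-invariant ergodic Borel
probability measure `ν`, then there are Borel sets `A' ⊆ A`, `B' ⊆ B` and a Borel bijection
`φ : A' → B'` moving points within their `G`-orbits, with `ν(A \ A') = ν(B \ B') = 0` for
every invariant ergodic `ν`. -/
theorem exists_borel_orbit_bijection
    {G X : Type*} [Group G] [Countable G] [MeasurableSpace X] [StandardBorelSpace X]
    [MulAction G X]
    (hmeas : ∀ g : G, Measurable (fun x : X => g • x))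
    (A B : Set X) (hA : MeasurableSet A) (hB : MeasurableSet B)
    (hAB : ∀ ν : Measure X, IsErgodicInvariant G ν → ν A = ν B) :
    ∃ (A' B' : Set X) (φ : X → X), MeasurableSet A' ∧ MeasurableSet B' ∧
      A' ⊆ A ∧ B' ⊆ B ∧ Measurable φ ∧ Set.BijOn φ A' B' ∧
      (∀ x ∈ A', φ x ∈ MulAction.orbit G x) ∧
      ∀ ν : Measure X, IsErgodicInvariant G ν → ν (A \ A') = 0 ∧ ν (B \ B') = 0 := by
  obtain ⟨e, he⟩ := exists_surjective_nat G
  have hC := measurableSet_greedyDomain e hmeas hA hB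
  have hD := measurableSet_greedyRange e hmeas hA hB
  have hCA : ⋃ n, greedyDomain e A B n ⊆ A :=
    Set.iUnion_subset fun n x hx => antitone_greedyRemainder_fst e A B (Nat.zero_le n) hx.1
  have hDB : ⋃ n, greedyRange e A B n ⊆ B :=
    Set.iUnion_subset fun n x hx => antitone_greedyRemainder_snd e A B (Nat.zero_le n) hx.1
  obtain ⟨φ, hφ, hφe⟩ := exists_measurable_piecewise (greedyDomain e A B) hC
    (fun n x => e n • x) (fun n => hmeas (e n)) fun m n hmn x hx =>
      (Set.disjoint_left.1 (pairwise_disjoint_greedyDomain e A B hmn) hx.1 hx.2).elim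
  have hφD : ∀ n, ∀ x ∈ greedyDomain e A B n, φ x ∈ greedyRange e A B n := fun n x hx => by
    rw [hφe n hx]
    exact (smul_mem_greedyRange_iff e A B n x).2 hx
  refine ⟨⋃ n, greedyDomain e A B n, ⋃ n, greedyRange e A B n, φ, .iUnion hC, .iUnion hD,
    hCA, hDB, hφ, ⟨?_, ?_, ?_⟩, ?_, ?_⟩
  · intro x hx
    obtain ⟨n, hn⟩ := Set.mem_iUnion.1 hx
    exact Set.mem_iUnion_of_mem n (hφD n x hn)
  · intro x hx y hy hxy
    obtain ⟨m, hm⟩ := Set.mem_iUnion.1 hx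
    obtain ⟨n, hn⟩ := Set.mem_iUnion.1 hy
    obtain rfl : m = n := by
      by_contra hmn
      exact Set.disjoint_left.1 (pairwise_disjoint_greedyRange e A B hmn) (hφD m x hm)
        (hxy ▸ hφD n y hn)
    rw [hφe m hm, hφe m hn] at hxy
    exact MulAction.injective _ hxy
  · intro y hy
    obtain ⟨n, hn⟩ := Set.mem_iUnion.1 hy
    rw [greedyRange_eq_preimage] at hn
    exact ⟨(e n)⁻¹ • y, Set.mem_iUnion_of_mem n hn, by simp [hφe n hn]⟩
  · intro x hx
    obtain ⟨n, hn⟩ := Set.mem_iUnion.1 hx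
    exact ⟨e n, (hφe n hn).symm⟩
  · intro ν hν
    have := hν.1
    have hdiff : ν (A \ ⋃ n, greedyDomain e A B n) = ν (B \ ⋃ n, greedyRange e A B n) := by
      rw [measure_sdiff hCA (MeasurableSet.iUnion hC).nullMeasurableSet (measure_ne_top _ _),
        measure_sdiff hDB (MeasurableSet.iUnion hD).nullMeasurableSet (measure_ne_top _ _),
        hAB ν hν, measure_iUnion_greedyDomain_eq e hmeas hA hB hν.2.1]
    rcases hν.measure_eq_zero_or_of_forall_smul_notMem hmeas (hA.diff (.iUnion hC))
      (he.forall.2 fun n x hx => smul_notMem_diff_iUnion_greedyRange e A B n hx) with h | h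
    · exact ⟨h, hdiff ▸ h⟩
    · exact ⟨hdiff ▸ h, h⟩
end

section
/- There is a monotone increasing continuous function θ : [0, ∞) → [0, 2) with θ(0) = 0 satisfying the following property. If p = (p_i)_{i ∈ ℕ} is a probability vector with p_0 = max_i p_i and H(p) < ∞ then, setting p^t = t·e + (1 − t)·p for t ∈ [0, 1], where e is the probability vector with 0-th coordinate 1 and all other coordinates 0, one has H(p^t) ≤ H(p) and |p − p^t| ≤ θ(H(p) − H(p^t)) for all t ∈ [0, 1]. -/
/-- The Bretagnolle–Huber inequality for two Bernoulli distributions. -/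
theorem neg_log_one_sub_sq_le_binary_klDiv {a b : ℝ} (ha : 0 < a) (hab : a ≤ b) (hb : b ≤ 1) :
    -Real.log (1 - (b - a) ^ 2) ≤
      b * (Real.log b - Real.log a) + (1 - b) * (Real.log (1 - b) - Real.log (1 - a)) := by
  have log_ratio_le : ∀ x y c : ℝ, 0 < x → 0 < y → 0 < c →
      y * (Real.log x - Real.log y - 2 * Real.log c) ≤ 2 * (√x * √y / c - y) := by
    intro x y c hx hy hc
    have hx' := Real.sqrt_pos.2 hx
    have hy' := Real.sqrt_pos.2 hy
    have h := Real.log_le_sub_one_of_pos (div_pos hx' (mul_pos hy' hc))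
    rw [Real.log_div hx'.ne' (mul_pos hy' hc).ne', Real.log_mul hy'.ne' hc.ne',
      Real.log_sqrt hx.le, Real.log_sqrt hy.le] at h
    have h2 := mul_le_mul_of_nonneg_left h hy.le
    have h3 : y * (√x / (√y * c) - 1) = √x * √y / c - y := by
      field_simp
      linear_combination -√x * Real.sq_sqrt hy.le
    linarith
  have hb0 : 0 < b := ha.trans_le hab
  set A := √a with hA
  set B := √b with hB
  set E := √(1 - a) with hE
  set F := √(1 - b) with hF
  have hA2 : A ^ 2 = a := Real.sq_sqrt ha.le
  have hB2 : B ^ 2 = b := Real.sq_sqrt hb0.le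
  have hE2 : E ^ 2 = 1 - a := Real.sq_sqrt (by linarith)
  have hF2 : F ^ 2 = 1 - b := Real.sq_sqrt (by linarith)
  have hEF : 0 ≤ E * F := mul_nonneg (Real.sqrt_nonneg _) (Real.sqrt_nonneg _)
  have hC : 0 < A * B + E * F :=
    add_pos_of_pos_of_nonneg (mul_pos (Real.sqrt_pos.2 ha) (Real.sqrt_pos.2 hb0)) hEF
  have hC2 : (A * B + E * F) ^ 2 ≤ 1 - (b - a) ^ 2 := by
    have : 1 - (b - a) ^ 2 - (A * B + E * F) ^ 2 = (A * E - B * F) ^ 2 := by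
      have : (A * B + E * F) ^ 2 + (A * E - B * F) ^ 2 =
        A ^ 2 * B ^ 2 + E ^ 2 * F ^ 2 + A ^ 2 * E ^ 2 + B ^ 2 * F ^ 2 := by ring
      rw [hA2, hB2, hE2, hF2] at this
      linarith
    nlinarith [sq_nonneg (A * E - B * F)]
  have hlog := Real.log_le_log (by positivity) hC2
  rw [Real.log_pow] at hlog
  push_cast at hlog
  have h1 := log_ratio_le a b _ ha hb0 hC
  have h2 : (1 - b) * (Real.log (1 - a) - Real.log (1 - b) - 2 * Real.log (A * B + E * F)) ≤
      2 * (E * F / (A * B + E * F) - (1 - b)) := by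
    rcases hb.eq_or_lt with rfl | hb1
    · have : 0 ≤ E * F / (A * B + E * F) := by positivity
      simpa using this
    · exact log_ratio_le (1 - a) (1 - b) _ (by linarith) (by linarith) hC
  have h3 : A * B / (A * B + E * F) + E * F / (A * B + E * F) = 1 := by
    field_simp
  nlinarith

/-- Moving a probability vector with largest coordinate `p 0` towards the point mass at `0`
decreases its entropy by at least the binary divergence between the masses at `0`. -/
theorem binary_klDiv_le_entropy_sub {p : ℕ → ℝ} (hp : ∀ i, 0 ≤ p i) (hsum : HasSum p 1)
    (hmax : ∀ i, p i ≤ p 0) (hH : Summable fun i => Real.negMulLog (p i)) {t : ℝ}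
    (ht : t ∈ Set.Icc (0 : ℝ) 1) :
    (t + (1 - t) * p 0) * (Real.log (t + (1 - t) * p 0) - Real.log (p 0)) +
        (1 - (t + (1 - t) * p 0)) *
          (Real.log (1 - (t + (1 - t) * p 0)) - Real.log (1 - p 0)) ≤
      (∑' i, Real.negMulLog (p i)) -
        ∑' i, Real.negMulLog ((if i = 0 then t else 0) + (1 - t) * p i) := by
  have htail : HasSum (fun i => p (i + 1)) (1 - p 0) := by
    rw [hasSum_nat_add_iff (f := p) 1]
    simpa using hsum
  have hHtail : Summable fun i => Real.negMulLog (p (i + 1)) :=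
    (summable_nat_add_iff (f := fun i => Real.negMulLog (p i)) 1).2 hH
  have hpath : HasSum
      (fun i => Real.negMulLog ((if i + 1 = 0 then t else 0) + (1 - t) * p (i + 1)))
      (Real.negMulLog (1 - t) * (1 - p 0) +
        (1 - t) * ∑' i, Real.negMulLog (p (i + 1))) := by
    refine ((htail.mul_left _).add (hHtail.hasSum.mul_left (1 - t))).congr_fun ?_
    intro i
    simp only [Nat.add_eq_zero_iff, one_ne_zero, and_false, if_false, zero_add,
      Real.negMulLog_mul]
    ring
  have hpathS := (summable_nat_add_iff
    (f := fun i => Real.negMulLog ((if i = 0 then t else 0) + (1 - t) * p i)) 1).1 hpath.summable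
  have hS : -Real.log (p 0) * (1 - p 0) ≤ ∑' i, Real.negMulLog (p (i + 1)) := by
    refine hasSum_le (fun i => ?_) (htail.mul_left _) hHtail.hasSum
    rcases (hp (i + 1)).eq_or_lt with h | h
    · simp [← h]
    · have := mul_le_mul_of_nonneg_left (Real.log_le_log h (hmax (i + 1))) h.le
      rw [Real.negMulLog]
      linarith
  have hlog : (1 - (t + (1 - t) * p 0)) *
      (Real.log (1 - (t + (1 - t) * p 0)) - Real.log (1 - p 0)) =
      (1 - p 0) * ((1 - t) * Real.log (1 - t)) := by
    rw [show 1 - (t + (1 - t) * p 0) = (1 - t) * (1 - p 0) by ring]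
    by_cases h1 : 1 - t = 0
    · simp [h1]
    by_cases h2 : 1 - p 0 = 0
    · simp [h2]
    rw [Real.log_mul h1 h2]
    ring
  rw [hH.tsum_eq_zero_add, hpathS.tsum_eq_zero_add, hpath.tsum_eq, hlog]
  simp only [if_true, Real.negMulLog]
  simp only [Real.negMulLog] at hS
  have := mul_le_mul_of_nonneg_left hS ht.1
  nlinarith

/-- The `ℓ¹` distance travelled towards the point mass at `0`. -/
theorem tsum_abs_sub_path {p : ℕ → ℝ} (hp : ∀ i, 0 ≤ p i) (hsum : HasSum p 1) {t : ℝ}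
    (ht : 0 ≤ t) :
    ∑' i, |p i - ((if i = 0 then t else 0) + (1 - t) * p i)| = 2 * (t * (1 - p 0)) := by
  have hp0 : p 0 ≤ 1 := le_hasSum hsum 0 fun i _ => hp i
  have htail : HasSum (fun i => p (i + 1)) (1 - p 0) := by
    rw [hasSum_nat_add_iff (f := p) 1]
    simpa using hsum
  have hdist : HasSum
      (fun i => |p (i + 1) - ((if i + 1 = 0 then t else 0) + (1 - t) * p (i + 1))|)
      (t * (1 - p 0)) := by
    refine (htail.mul_left t).congr_fun fun i => ?_
    rw [if_neg i.succ_ne_zero, ← abs_of_nonneg (mul_nonneg ht (hp (i + 1)))]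
    congr 1
    ring
  have hdistS := (summable_nat_add_iff
    (f := fun i => |p i - ((if i = 0 then t else 0) + (1 - t) * p i)|) 1).1 hdist.summable
  rw [hdistS.tsum_eq_zero_add, hdist.tsum_eq, if_pos rfl,
    show p 0 - (t + (1 - t) * p 0) = -(t * (1 - p 0)) by ring, abs_neg,
    abs_of_nonneg (mul_nonneg ht (by linarith))]
  ring

/-- There is a monotone increasing continuous function `θ : [0, ∞) → [0, 2)` with `θ(0) = 0`
such that for every probability vector `p` with `p 0 = max p` and `H(p) < ∞`, the path
`p^t = t·e₀ + (1 − t)·p` (`e₀` the point mass at `0`) satisfies `H(p^t) ≤ H(p)` and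
`|p − p^t| ≤ θ(H(p) − H(p^t))` for all `t ∈ [0, 1]`. -/
theorem exists_entropy_path_modulus :
    ∃ θ : ℝ → ℝ, ContinuousOn θ (Set.Ici 0) ∧ MonotoneOn θ (Set.Ici 0) ∧ θ 0 = 0 ∧
      (∀ x ∈ Set.Ici (0 : ℝ), θ x ∈ Set.Ico (0 : ℝ) 2) ∧
      ∀ p : ℕ → ℝ, (∀ i, 0 ≤ p i) → HasSum p 1 → (∀ i, p i ≤ p 0) →
        Summable (fun i => Real.negMulLog (p i)) →
        ∀ t ∈ Set.Icc (0 : ℝ) 1,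
          (∑' i, Real.negMulLog ((if i = 0 then t else 0) + (1 - t) * p i)) ≤
              (∑' i, Real.negMulLog (p i)) ∧
          (∑' i, |p i - ((if i = 0 then t else 0) + (1 - t) * p i)|) ≤
            θ ((∑' i, Real.negMulLog (p i)) -
                ∑' i, Real.negMulLog ((if i = 0 then t else 0) + (1 - t) * p i)) := by
  refine ⟨fun x => 2 * √(1 - Real.exp (-x)), by fun_prop, fun x _ y _ hxy => ?_, by simp,
    fun x _ => ⟨by positivity, ?_⟩, fun p hp hsum hmax hH t ht => ?_⟩
  · dsimp only
    gcongr
  · have h : √(1 - Real.exp (-x)) < 1 := by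
      rw [Real.sqrt_lt' one_pos]
      linarith [Real.exp_pos (-x)]
    dsimp only
    linarith
  have hp1 : p 0 ≤ 1 := le_hasSum hsum 0 fun i _ => hp i
  have hp0 : 0 < p 0 := by
    refine (hp 0).lt_of_ne fun h => ?_
    have : p = 0 := funext fun i => le_antisymm ((hmax i).trans_eq h.symm) (hp i)
    rw [this] at hsum
    exact zero_ne_one (hasSum_zero.unique hsum)
  have hu0 : 0 ≤ t * (1 - p 0) := mul_nonneg ht.1 (by linarith)
  have hu1 : t * (1 - p 0) < 1 := by nlinarith [ht.2]
  have hD := (neg_log_one_sub_sq_le_binary_klDiv hp0 (b := t + (1 - t) * p 0)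
    (by linarith) (by nlinarith [ht.2])).trans (binary_klDiv_le_entropy_sub hp hsum hmax hH ht)
  rw [show t + (1 - t) * p 0 - p 0 = t * (1 - p 0) by ring] at hD
  have hpos : 0 < 1 - (t * (1 - p 0)) ^ 2 := by nlinarith
  refine ⟨?_, ?_⟩
  · have := Real.log_nonpos hpos.le (by nlinarith)
    linarith
  · rw [tsum_abs_sub_path hp hsum ht.1]
    refine mul_le_mul_of_nonneg_left (Real.le_sqrt_of_sq_le ?_) zero_le_two
    have := (Real.exp_le_exp.2 (neg_le.1 hD)).trans_eq (Real.exp_log hpos)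
    linarith
end
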